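/- arXiv:1910.00209 — 4 statements merged into one kernel-verified Lean document; each statement's English description precedes it below -/
import Mathlib

section
/- Let n ≥ 0 and let K be any subfield of the 2^n-th cyclotomic field ℚ_{2^n}. Then there exists a 2^n-th root of unity ζ (not necessarily primitive) such that K = ℚ(ξ) where ξ is one of ζ, ζ + ζ̄, or ζ − ζ̄ (here ζ̄ = ζ^{-1} denotes complex conjugation). -/
open CategoryTheory Module Pointwise
open scoped MatrixGroups

/-- The set of all values `χ(g)` of irreducible complex characters `χ` of `G`. -/
noncomputable def charValues (G : Type) [Group G] : Set ℂ :=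
  {z : ℂ | ∃ V : FDRep ℂ G, Simple V ∧ ∃ g : G, V.character g = z}

/-- `ℚ(G)`, the field of character values of `G`, as a subfield of `ℂ`. -/
noncomputable def charField (G : Type) [Group G] : Subfield ℂ :=
  Subfield.closure (charValues G)

/-- `ℤ[G]`, the subring of `ℂ` generated by the character values of `G`. -/
noncomputable def charRing (G : Type) [Group G] : Subring ℂ :=
  Subring.closure (charValues G)

/-- The ring of integers of a subfield `K` of `ℂ`, i.e. the elements of `K` integral
over `ℤ`, as a subring of `ℂ`. -/
noncomputable def ringOfIntIn (K : Subfield ℂ) : Subring ℂ :=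
  (integralClosure ℤ ℂ).toSubring ⊓ K.toSubring

/-- The additive quotient group `ℤ_{ℚ(G)}/ℤ[G]`. -/
noncomputable def charQuot (G : Type) [Group G] :=
  ↥((ringOfIntIn (charField G)).toAddSubgroup) ⧸
    ((charRing G).toAddSubgroup.addSubgroupOf (ringOfIntIn (charField G)).toAddSubgroup)

noncomputable instance (G : Type) [Group G] : AddCommGroup (charQuot G) := by
  unfold charQuot; infer_instance

/-- The `m`-th cyclotomic field `ℚ(ζ_m)`, as the subfield of `ℂ` generated by the
`m`-th roots of unity. -/
noncomputable def cycField (m : ℕ) : Subfield ℂ :=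
  Subfield.closure {z : ℂ | z ^ m = 1}

/-- The set of values `χ(g)` at a fixed `g` of irreducible complex characters `χ` of `G`. -/
noncomputable def charValuesAt {G : Type} [Group G] (g : G) : Set ℂ :=
  {z : ℂ | ∃ V : FDRep ℂ G, Simple V ∧ V.character g = z}

/-- `ℚ(g)`, the subfield of `ℂ` generated by one column of the character table. -/
noncomputable def charFieldAt {G : Type} [Group G] (g : G) : Subfield ℂ :=
  Subfield.closure (charValuesAt g)

/-- `ℤ[g]`, the subring of `ℂ` generated by one column of the character table. -/
noncomputable def charRingAt {G : Type} [Group G] (g : G) : Subring ℂ :=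
  Subring.closure (charValuesAt g)

section TwoPowerCyclotomic

open IntermediateField

namespace IsGalois

variable {F E : Type*} [Field F] [Field E] [Algebra F E] [FiniteDimensional F E] [IsGalois F E]

theorem mem_intermediateField_iff_forall_fixingSubgroup {K : IntermediateField F E} {x : E} :
    x ∈ K ↔ ∀ σ ∈ K.fixingSubgroup, σ x = x := by
  refine ⟨fun hx σ hσ ↦ (mem_fixingSubgroup_iff K σ).1 hσ x hx, fun h ↦ ?_⟩
  rw [← IsGalois.fixedField_fixingSubgroup K]
  exact (IntermediateField.mem_fixedField_iff _ _).2 h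

theorem le_adjoin_simple_of_forall {K : IntermediateField F E} {x : E}
    (h : ∀ σ : E ≃ₐ[F] E, σ x = x → σ ∈ K.fixingSubgroup) : K ≤ F⟮x⟯ := by
  rw [← IsGalois.fixedField_fixingSubgroup F⟮x⟯, IntermediateField.le_iff_le]
  exact fun σ hσ ↦ h σ ((mem_fixingSubgroup_iff _ σ).1 hσ x (mem_adjoin_simple_self F x))

end IsGalois

theorem AlgEquiv.ext_of_adjoin_simple_eq_top {F E : Type*} [Field F] [Field E] [Algebra F E]
    {x : E} (hx : F⟮x⟯ = ⊤) {σ τ : E ≃ₐ[F] E} (h : σ x = τ x) : σ = τ := by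
  ext y
  have hy : y ∈ F⟮x⟯ := hx ▸ mem_top
  induction hy using adjoin_induction with
  | mem z hz => rwa [Set.mem_singleton_iff.1 hz]
  | algebraMap z => simp
  | add _ _ _ _ hy hz => rw [map_add, map_add, hy, hz]
  | inv _ _ hy => rw [map_inv₀, map_inv₀, hy]
  | mul _ _ _ _ hy hz => rw [map_mul, map_mul, hy, hz]

theorem exists_one_add_two_pow_mul_pow_two_pow {k u : ℕ} (hk : 2 ≤ k) (hu : Odd u) (d : ℕ) :
    ∃ v, Odd v ∧ (1 + 2 ^ k * u) ^ 2 ^ d = 1 + 2 ^ (k + d) * v := by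
  induction d with
  | zero => exact ⟨u, hu, by simp⟩
  | succ d ih =>
    obtain ⟨v, hv, h⟩ := ih
    obtain ⟨j, rfl⟩ := Nat.exists_eq_add_of_le hk
    refine ⟨v + 2 ^ (j + d + 1) * v ^ 2, ?_, ?_⟩
    · exact hv.add_even (Even.mul_right (by simp [Nat.even_pow]) _)
    · rw [pow_succ 2 d, pow_mul, h]
      ring

namespace IsPrimitiveRoot

section

variable {L : Type*} [Field L] {ζ : L} {m : ℕ}

theorem pow_two_pow_eq_neg_one (hζ : IsPrimitiveRoot ζ (2 ^ (m + 1))) : ζ ^ 2 ^ m = -1 := by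
  have h : (ζ ^ 2 ^ m) ^ 2 = 1 := by rw [← pow_mul, ← pow_succ]; exact hζ.pow_eq_one
  refine (sq_eq_one_iff.1 h).resolve_left ?_
  exact hζ.pow_ne_one_of_pos_of_lt (by positivity) (Nat.pow_lt_pow_right (by norm_num) (by omega))

theorem exists_pow_pow_eq_neg (hζ : IsPrimitiveRoot ζ (2 ^ (m + 1))) {a : ℕ} (ha : a % 4 = 1)
    (hne : ζ ^ a ≠ ζ) : ∃ j, ζ ^ a ^ j = -ζ := by
  obtain ⟨b, rfl⟩ : ∃ b, a = 1 + b := ⟨a - 1, by omega⟩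
  have hb : b ≠ 0 := by rintro rfl; simp at hne
  obtain ⟨k, u, hu, rfl⟩ := Nat.exists_eq_two_pow_mul_odd hb
  have hk : 2 ≤ k := by
    by_contra! hk
    obtain ⟨w, rfl⟩ := hu
    interval_cases k <;> omega
  have hkm : k ≤ m := by
    by_contra! hkm
    refine hne ?_
    obtain ⟨c, hc⟩ := pow_dvd_pow 2 (show m + 1 ≤ k from hkm)
    rw [pow_add, hc, mul_assoc, pow_mul, hζ.pow_eq_one]
    simp
  obtain ⟨v, hv, h⟩ := exists_one_add_two_pow_mul_pow_two_pow hk hu (m - k)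
  refine ⟨2 ^ (m - k), ?_⟩
  rw [h, Nat.add_sub_cancel' hkm, pow_add, pow_mul, hζ.pow_two_pow_eq_neg_one, hv.neg_one_pow]
  simp

theorem pow_eq_inv_or_eq_neg_inv (hζ : IsPrimitiveRoot ζ (2 ^ (m + 1))) {a : ℕ} (ha : a % 4 = 3)
    (h : ζ ^ a ^ 2 = ζ) : ζ ^ a = ζ⁻¹ ∨ ζ ^ a = -ζ⁻¹ := by
  have hζ0 : ζ ≠ 0 := hζ.ne_zero (by positivity)
  obtain ⟨b, rfl⟩ : ∃ b, a = 4 * b + 3 := ⟨a / 4, by omega⟩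
  have hdvd : 2 ^ (m + 1) ∣ (2 * b + 1) * ((4 * b + 3 + 1) * 2) := by
    refine hζ.dvd_of_pow_eq_one _ (mul_right_cancel₀ hζ0 ?_)
    rw [one_mul, ← pow_succ]
    convert h using 2
    ring
  have hcop : Nat.Coprime (2 ^ (m + 1)) (2 * b + 1) := Nat.Coprime.pow_left _ (by simp)
  have hsq : (ζ ^ (4 * b + 3 + 1)) ^ 2 = 1 := by
    rw [← pow_mul]
    exact (hζ.pow_eq_one_iff_dvd _).2 (hcop.dvd_of_dvd_mul_left hdvd)
  rw [pow_succ ζ (4 * b + 3)] at hsq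
  rcases sq_eq_one_iff.1 hsq with h1 | h1
  · left; field_simp; exact h1
  · right; field_simp; exact h1

end

variable {F L : Type*} [Field F] [Field L] [Algebra F L] {ζ : L} {m : ℕ}

/-- If no power of an automorphism maps `ζ`, primitive of order `2 ^ (m + 1)`, to `-ζ`, then the
automorphism fixes `ζ` or inverts it up to sign. -/
theorem exists_pow_apply_eq_neg_or (hζ : IsPrimitiveRoot ζ (2 ^ (m + 1))) (σ : L ≃ₐ[F] L) :
    (∃ j : ℕ, (σ ^ j) ζ = -ζ) ∨ σ ζ = ζ ∨ σ ζ = ζ⁻¹ ∨ σ ζ = -ζ⁻¹ := by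
  obtain ⟨a, -, ha⟩ := hζ.eq_pow_of_pow_eq_one (ξ := σ ζ) (by
    rw [← map_pow, hζ.pow_eq_one, map_one])
  have hpow (j : ℕ) : (σ ^ j) ζ = ζ ^ a ^ j := by
    induction j with
    | zero => simp
    | succ j ih => rw [pow_succ', AlgEquiv.mul_apply, ih, map_pow, ← ha, ← pow_mul, pow_succ']
  have hodd : Odd a := by
    have hσ := hζ.map_of_injective (f := σ) σ.injective
    rw [← ha, hζ.pow_iff_coprime (by positivity)] at hσ
    exact (Nat.Coprime.coprime_dvd_right (dvd_pow_self 2 (by omega)) hσ).odd_of_right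
  rw [← ha]
  by_cases hne : ζ ^ a = ζ
  · exact .inr (.inl hne)
  rcases (by obtain ⟨w, rfl⟩ := hodd; omega : a % 4 = 1 ∨ a % 4 = 3) with h4 | h4
  · obtain ⟨j, hj⟩ := hζ.exists_pow_pow_eq_neg h4 hne
    exact .inl ⟨j, (hpow j).trans hj⟩
  · by_cases h2 : ζ ^ a ^ 2 = ζ
    · exact .inr (.inr (hζ.pow_eq_inv_or_eq_neg_inv h4 h2))
    · obtain ⟨j, hj⟩ := hζ.exists_pow_pow_eq_neg (by simp [Nat.pow_mod, h4]) h2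
      exact .inl ⟨2 * j, by rw [hpow, pow_mul, hj]⟩

theorem intermediateField_le_adjoin_sq_or [FiniteDimensional F L] [IsGalois F L]
    (hζ : IsPrimitiveRoot ζ (2 ^ (m + 1))) (htop : F⟮ζ⟯ = ⊤) (K : IntermediateField F L) :
    K ≤ F⟮ζ ^ 2⟯ ∨ K = F⟮ζ⟯ ∨ K = F⟮ζ + ζ⁻¹⟯ ∨ K = F⟮ζ - ζ⁻¹⟯ := by
  have hζ0 : ζ ≠ 0 := hζ.ne_zero (by positivity)
  have mem_of_eq {σ τ : L ≃ₐ[F] L} (hσ : σ ∈ K.fixingSubgroup) (h : τ ζ = σ ζ) :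
      τ ∈ K.fixingSubgroup := by
    rwa [AlgEquiv.ext_of_adjoin_simple_eq_top htop h]
  have mem_of_fix {τ : L ≃ₐ[F] L} (h : τ ζ = ζ) : τ ∈ K.fixingSubgroup :=
    mem_of_eq (one_mem _) (by simpa using h)
  by_cases hneg : ∃ σ ∈ K.fixingSubgroup, σ ζ = -ζ
  · obtain ⟨σ, hσ, hσζ⟩ := hneg
    refine .inl (IsGalois.le_adjoin_simple_of_forall fun τ hτ ↦ ?_)
    rw [map_pow, sq_eq_sq_iff_eq_or_eq_neg] at hτ
    rcases hτ with h | h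
    · exact mem_of_fix h
    · exact mem_of_eq hσ (h.trans hσζ.symm)
  have hH (σ) (hσ : σ ∈ K.fixingSubgroup) : σ ζ = ζ ∨ σ ζ = ζ⁻¹ ∨ σ ζ = -ζ⁻¹ :=
    (hζ.exists_pow_apply_eq_neg_or σ).resolve_left fun ⟨j, hj⟩ ↦ hneg ⟨σ ^ j, pow_mem hσ j, hj⟩
  right
  by_cases hinv : ∃ σ ∈ K.fixingSubgroup, σ ζ = ζ⁻¹
  · obtain ⟨σ, hσ, hσζ⟩ := hinv
    refine .inr (.inl (le_antisymm (IsGalois.le_adjoin_simple_of_forall fun τ hτ ↦ ?_) ?_))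
    · have : (τ ζ - ζ) * (τ ζ - ζ⁻¹) = 0 := by
        have hτ0 : τ ζ ≠ 0 := by simpa using hζ0
        rw [map_add, map_inv₀] at hτ
        field_simp at hτ ⊢
        linear_combination hτ
      rcases mul_eq_zero.1 this with h | h
      · exact mem_of_fix (sub_eq_zero.1 h)
      · exact mem_of_eq hσ ((sub_eq_zero.1 h).trans hσζ.symm)
    · rw [adjoin_simple_le_iff, IsGalois.mem_intermediateField_iff_forall_fixingSubgroup]
      intro τ hτ
      rcases hH τ hτ with h | h | h
      · simp [h]
      · simp [h, add_comm]
      · exact (hneg ⟨σ * τ, mul_mem hσ hτ, by simp [h, hσζ]⟩).elim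
  by_cases hninv : ∃ σ ∈ K.fixingSubgroup, σ ζ = -ζ⁻¹
  · obtain ⟨σ, hσ, hσζ⟩ := hninv
    refine .inr (.inr (le_antisymm (IsGalois.le_adjoin_simple_of_forall fun τ hτ ↦ ?_) ?_))
    · have : (τ ζ - ζ) * (τ ζ + ζ⁻¹) = 0 := by
        have hτ0 : τ ζ ≠ 0 := by simpa using hζ0
        rw [map_sub, map_inv₀] at hτ
        field_simp at hτ ⊢
        linear_combination hτ
      rcases mul_eq_zero.1 this with h | h
      · exact mem_of_fix (sub_eq_zero.1 h)
      · exact mem_of_eq hσ ((eq_neg_of_add_eq_zero_left h).trans hσζ.symm)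
    · rw [adjoin_simple_le_iff, IsGalois.mem_intermediateField_iff_forall_fixingSubgroup]
      intro τ hτ
      rcases hH τ hτ with h | h | h
      · simp [h]
      · exact (hinv ⟨τ, hτ, h⟩).elim
      · simp [h, inv_neg]; ring
  left
  rw [htop, eq_top_iff, ← htop, adjoin_simple_le_iff,
    IsGalois.mem_intermediateField_iff_forall_fixingSubgroup]
  intro τ hτ
  rcases hH τ hτ with h | h | h
  · exact h
  · exact (hinv ⟨τ, hτ, h⟩).elim
  · exact (hninv ⟨τ, hτ, h⟩).elim

/-- An intermediate field of `F(ζ) / F`, with `ζ` primitive of order `2 ^ (m + 1)`, either lies in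
`F(ζ ^ 2)` or is generated by one of `ζ`, `ζ + ζ⁻¹`, `ζ - ζ⁻¹`. -/
theorem le_adjoin_sq_or_of_le_adjoin (hζ : IsPrimitiveRoot ζ (2 ^ (m + 1)))
    {K : IntermediateField F L} (hK : K ≤ F⟮ζ⟯) :
    K ≤ F⟮ζ ^ 2⟯ ∨ K = F⟮ζ⟯ ∨ K = F⟮ζ + ζ⁻¹⟯ ∨ K = F⟮ζ - ζ⁻¹⟯ := by
  have : IsCyclotomicExtension {2 ^ (m + 1)} F F⟮ζ⟯ :=
    (IntermediateField.isCyclotomicExtension_singleton_iff_eq_adjoin _ _ _ _ hζ).2 rfl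
  have := IsCyclotomicExtension.isGalois {2 ^ (m + 1)} F F⟮ζ⟯
  have := IsCyclotomicExtension.finiteDimensional {2 ^ (m + 1)} F F⟮ζ⟯
  let z : F⟮ζ⟯ := AdjoinSimple.gen F ζ
  have hz : IsPrimitiveRoot z (2 ^ (m + 1)) := by
    refine IsPrimitiveRoot.of_map_of_injective (f := F⟮ζ⟯.val) ?_ F⟮ζ⟯.val.injective
    exact hζ
  have htop : F⟮z⟯ = ⊤ := lift_injective _ (by rw [lift_adjoin_simple, lift_top]; rfl)
  have hlift : lift (restrict hK) = K := lift_restrict hK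
  rcases hz.intermediateField_le_adjoin_sq_or htop (restrict hK) with h | h | h | h
  · left
    have h' := IntermediateField.map_mono F⟮ζ⟯.val h
    change lift _ ≤ lift _ at h'
    rw [hlift, lift_adjoin_simple] at h'
    exact h'
  all_goals
    have h' := congrArg lift h
    rw [hlift, lift_adjoin_simple] at h'
  · exact .inr (.inl h')
  · exact .inr (.inr (.inl h'))
  · exact .inr (.inr (.inr h'))

end IsPrimitiveRoot

theorem IntermediateField.adjoin_rat_toSubfield {E : Type*} [Field E] [Algebra ℚ E] (S : Set E) :
    (adjoin ℚ S).toSubfield = Subfield.closure S := by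
  rw [adjoin_toSubfield, Subfield.closure_union, sup_eq_right]
  refine Subfield.closure_le.2 ?_
  rintro _ ⟨q, rfl⟩
  rw [eq_ratCast]
  exact SubfieldClass.ratCast_mem _ q

theorem cycField_eq_adjoin_toSubfield {k : ℕ} [NeZero k] {ζ : ℂ} (hζ : IsPrimitiveRoot ζ k) :
    cycField k = ℚ⟮ζ⟯.toSubfield := by
  rw [adjoin_rat_toSubfield]
  refine le_antisymm (Subfield.closure_le.2 fun z hz ↦ ?_) (Subfield.closure_mono ?_)
  · obtain ⟨i, -, rfl⟩ := hζ.eq_pow_of_pow_eq_one hz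
    exact pow_mem (Subfield.subset_closure (Set.mem_singleton ζ)) i
  · exact Set.singleton_subset_iff.2 hζ.pow_eq_one

theorem IsPrimitiveRoot.subfield_le_cycField_or {ζ : ℂ} {m : ℕ}
    (hζ : IsPrimitiveRoot ζ (2 ^ (m + 1))) {K : Subfield ℂ} (hK : K ≤ cycField (2 ^ (m + 1))) :
    K ≤ cycField (2 ^ m) ∨ K = Subfield.closure {ζ} ∨ K = Subfield.closure {ζ + ζ⁻¹} ∨
      K = Subfield.closure {ζ - ζ⁻¹} := by
  rw [cycField_eq_adjoin_toSubfield hζ] at hK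
  have hζ2 : IsPrimitiveRoot (ζ ^ 2) (2 ^ m) := hζ.pow (by positivity) (pow_succ' 2 m)
  rw [cycField_eq_adjoin_toSubfield hζ2]
  obtain ⟨K, rfl⟩ : ∃ K' : IntermediateField ℚ ℂ, K'.toSubfield = K :=
    ⟨K.toIntermediateField fun q ↦ by rw [eq_ratCast]; exact SubfieldClass.ratCast_mem K q, rfl⟩
  simp only [← adjoin_rat_toSubfield, toSubfield_inj]
  exact hζ.le_adjoin_sq_or_of_le_adjoin hK

end TwoPowerCyclotomic

/-- Every subfield of the `2^n`-th cyclotomic field is of the form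
`ℚ(ξ)` with `ξ ∈ {ζ, ζ + ζ̄, ζ - ζ̄}` for some `2^n`-th root of unity `ζ`
(where `ζ̄ = ζ⁻¹`). -/
theorem subfield_of_cycField_two_pow (n : ℕ) (K : Subfield ℂ) (hK : K ≤ cycField (2 ^ n)) :
    ∃ ζ : ℂ, ζ ^ (2 ^ n) = 1 ∧
      (K = Subfield.closure {ζ} ∨ K = Subfield.closure {ζ + ζ⁻¹} ∨
        K = Subfield.closure {ζ - ζ⁻¹}) := by
  induction n with
  | zero =>
    refine ⟨1, one_pow _, .inl (le_antisymm ?_ ?_)⟩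
    · simpa [cycField] using hK
    · exact Subfield.closure_le.2 (Set.singleton_subset_iff.2 (one_mem K))
  | succ n ih =>
    have hζ := Complex.isPrimitiveRoot_exp (2 ^ (n + 1)) (by positivity)
    rcases hζ.subfield_le_cycField_or hK with h | h
    · obtain ⟨ζ, hpow, hgen⟩ := ih h
      exact ⟨ζ, by rw [pow_succ, pow_mul, hpow, one_pow], hgen⟩
    · exact ⟨_, hζ.pow_eq_one, h⟩
end

section
/- Let n ≥ 3, let ζ ∈ ℂ be a primitive 2^n-th root of unity, fix a sign ε ∈ {+1, −1}, and let K := ℚ(ζ + ε·ζ̄). Then the ring of integers ℤ_K of K is generated as an abelian group by the element 1 together with the elements ζ^k + (ε·ζ̄)^k for k = 1, …, 2^{n−2} − 1. -/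
open CategoryTheory Module Pointwise
open scoped MatrixGroups

open Polynomial in
/-- A rational polynomial vanishing at one primitive root of unity vanishes at all primitive
roots of unity of the same order. -/
theorem IsPrimitiveRoot.aeval_rat_eq_zero {K : Type*} [Field K] [CharZero K] {N : ℕ}
    (hN : 0 < N) {ζ η : K} (hζ : IsPrimitiveRoot ζ N) (hη : IsPrimitiveRoot η N) {p : ℚ[X]}
    (hp : aeval ζ p = 0) : aeval η p = 0 := by
  have hdvd := minpoly.dvd ℚ ζ hp
  rw [← cyclotomic_eq_minpoly_rat hζ hN, cyclotomic_eq_minpoly_rat hη hN] at hdvd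
  exact aeval_eq_zero_of_dvd_aeval_eq_zero hdvd (minpoly.aeval ℚ η)

/-- The powers `ζ ^ k`, `k < φ(N)`, of a primitive `N`-th root of unity are linearly independent
over `ℤ`. -/
theorem IsPrimitiveRoot.eq_zero_of_sum_pow_eq_zero {K : Type*} [Field K] [CharZero K] {N : ℕ}
    (hN : 0 < N) {ζ : K} (hζ : IsPrimitiveRoot ζ N) {c : ℕ → ℤ}
    (hc : ∑ k ∈ Finset.range N.totient, (c k : K) * ζ ^ k = 0) {k : ℕ} (hk : k < N.totient) :
    c k = 0 := by
  have hdeg : (minpoly ℚ ζ).natDegree = N.totient := by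
    rw [← Polynomial.cyclotomic_eq_minpoly_rat hζ hN, Polynomial.natDegree_cyclotomic]
  have hli := linearIndependent_pow (K := ℚ) ζ
  rw [hdeg, Fintype.linearIndependent_iff] at hli
  have h0 := hli (fun i => (c i : ℚ)) (by
    rw [← hc, Finset.sum_range]
    exact Finset.sum_congr rfl fun i _ => by simp [Algebra.smul_def]) ⟨k, hk⟩
  exact_mod_cast h0

/-- An algebraic integer in the `p ^ k`-th cyclotomic field is an integral combination of the
powers of `ζ` with exponent less than `φ(p ^ k)`. -/
theorem IsPrimitiveRoot.exists_int_sum_pow_of_isIntegral {L : Type*} [Field L] [CharZero L]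
    {p k : ℕ} [Fact p.Prime] {ζ : L} (hζ : IsPrimitiveRoot ζ (p ^ k)) {x : L}
    (hx : IsIntegral ℤ x) (hxK : x ∈ IntermediateField.adjoin ℚ {ζ}) :
    ∃ a : ℕ → ℤ, x = ∑ i ∈ Finset.range (p ^ k).totient, (a i : L) * ζ ^ i := by
  have hN : 0 < p ^ k := pow_pos (Fact.out : p.Prime).pos k
  have : NeZero (p ^ k) := ⟨hN.ne'⟩
  set F := IntermediateField.adjoin ℚ {ζ} with hF
  have hint : IsIntegral ℤ ζ := hζ.isIntegral hN
  have hcyc : IsCyclotomicExtension {p ^ k} ℚ F := by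
    change IsCyclotomicExtension {p ^ k} ℚ F.toSubalgebra
    rw [hF, IntermediateField.adjoin_simple_toSubalgebra_of_isAlgebraic
      (hint.tower_top (A := ℚ)).isAlgebraic]
    exact hζ.adjoin_isCyclotomicExtension ℚ
  let z : F := ⟨ζ, IntermediateField.mem_adjoin_simple_self ℚ ζ⟩
  have hz : IsPrimitiveRoot z (p ^ k) :=
    IsPrimitiveRoot.of_map_of_injective (f := F.val) hζ F.val.injective
  have hcl := IsCyclotomicExtension.Rat.isIntegralClosure_adjoin_singleton_of_prime_pow hz
  have hxF : IsIntegral ℤ (⟨x, hxK⟩ : F) :=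
    (isIntegral_algHom_iff (F.val.restrictScalars ℤ) F.val.injective).1 hx
  obtain ⟨⟨y, hy⟩, hyx⟩ := hcl.isIntegral_iff.1 hxF
  rw [Algebra.adjoin_singleton_eq_range_aeval] at hy
  obtain ⟨q, rfl⟩ := hy
  have hqx : Polynomial.aeval ζ q = x := by
    have h2 := congrArg (F.val.restrictScalars ℤ) hyx
    change (F.val.restrictScalars ℤ) (Polynomial.aeval z q) = x at h2
    rw [← Polynomial.aeval_algHom_apply] at h2
    exact h2
  have hmonic := Polynomial.cyclotomic.monic (p ^ k) ℤ
  have hroot : Polynomial.aeval ζ (Polynomial.cyclotomic (p ^ k) ℤ) = 0 := by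
    rw [Polynomial.cyclotomic_eq_minpoly hζ hN]
    exact minpoly.aeval ℤ ζ
  have hdeg : (q %ₘ Polynomial.cyclotomic (p ^ k) ℤ).degree < (p ^ k).totient := by
    rw [← Polynomial.degree_cyclotomic (p ^ k) ℤ]
    exact Polynomial.degree_modByMonic_lt _ hmonic
  refine ⟨(q %ₘ Polynomial.cyclotomic (p ^ k) ℤ).coeff, ?_⟩
  rw [← hqx, ← Polynomial.aeval_modByMonic_eq_self_of_root hroot]
  by_cases h0 : q %ₘ Polynomial.cyclotomic (p ^ k) ℤ = 0
  · simp [h0]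
  · rw [Polynomial.aeval_eq_sum_range' ((Polynomial.natDegree_lt_iff_degree_lt h0).2 hdeg)]
    simp [zsmul_eq_mul]

/-- An element of the field generated by an algebraic `s` is a rational polynomial in `s`. -/
theorem exists_aeval_eq_of_mem_subfield_closure {L : Type*} [Field L] [CharZero L] {s x : L}
    (hs : IsAlgebraic ℚ s) (hx : x ∈ Subfield.closure {s}) :
    ∃ q : Polynomial ℚ, Polynomial.aeval s q = x := by
  have hle : Subfield.closure {s} ≤ (IntermediateField.adjoin ℚ {s}).toSubfield :=
    Subfield.closure_le.2 <| Set.singleton_subset_iff.2 <|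
      IntermediateField.mem_adjoin_simple_self ℚ s
  have hmem : x ∈ (IntermediateField.adjoin ℚ {s}).toSubalgebra := hle hx
  rw [IntermediateField.adjoin_simple_toSubalgebra_of_isAlgebraic hs,
    Algebra.adjoin_singleton_eq_range_aeval] at hmem
  exact hmem

/-- The power sums of `z` and `w` lie in every subring containing `z + w` and `z * w`. -/
theorem Subring.pow_add_pow_mem {R : Type*} [CommRing R] (S : Subring R) {z w : R}
    (hadd : z + w ∈ S) (hmul : z * w ∈ S) (k : ℕ) : z ^ k + w ^ k ∈ S := by
  induction k using Nat.twoStepInduction with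
  | zero => simpa using S.add_mem S.one_mem S.one_mem
  | one => simpa using hadd
  | more k h0 h1 =>
    have h2 := S.sub_mem (S.mul_mem hadd h1) (S.mul_mem hmul h0)
    convert h2 using 1
    ring

/-- Folding the sum `∑ a k * z ^ k` over `k < 2 * (g + 1)` along `k ↦ 2 * (g + 1) - k`. -/
theorem sum_range_eq_add_sum_pow_add_pow {R : Type*} [CommRing R] {g : ℕ} {z w : R} {a : ℕ → R}
    (hmid : a (g + 1) = 0)
    (hfold : ∀ i < g, a (2 * g + 1 - i) * z ^ (2 * g + 1 - i) = a (i + 1) * w ^ (i + 1)) :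
    ∑ k ∈ Finset.range (2 * (g + 1)), a k * z ^ k =
      a 0 + ∑ i ∈ Finset.range g, a (i + 1) * (z ^ (i + 1) + w ^ (i + 1)) := by
  have hupper : ∑ i ∈ Finset.range g, a (g + (i + 1) + 1) * z ^ (g + (i + 1) + 1) =
      ∑ i ∈ Finset.range g, a (i + 1) * w ^ (i + 1) := by
    rw [← Finset.sum_range_reflect]
    refine Finset.sum_congr rfl fun i hi => ?_
    have hi' := Finset.mem_range.1 hi
    rw [← hfold i hi', show g + (g - 1 - i + 1) + 1 = 2 * g + 1 - i by omega]
  rw [show 2 * (g + 1) = g + (g + 1) + 1 by ring, Finset.sum_range_succ', Finset.sum_range_add,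
    Finset.sum_range_succ' _ g, hupper]
  simp only [mul_add, Finset.sum_add_distrib, add_zero, hmid, zero_mul, pow_zero, mul_one]
  ring

/-- If an integral combination of the powers of `ζ` is unchanged when `ζ` is replaced by
`e * ζ⁻¹` with `e = ±1`, its coefficients are antisymmetric up to the sign `e ^ k`. -/
theorem IsPrimitiveRoot.coeff_eq_neg_of_sum_eq {K : Type*} [Field K] [CharZero K] {N m : ℕ}
    (hN : 0 < N) (hm : N.totient = 2 * m) {ζ : K} (hζ : IsPrimitiveRoot ζ N)
    (hpow : ζ ^ (2 * m) = -1) {e : ℤ} (he : e ^ 2 = 1) {a : ℕ → ℤ}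
    (ha : ∑ k ∈ Finset.range (2 * m), (a k : K) * ζ ^ k =
      ∑ k ∈ Finset.range (2 * m), (a k : K) * (e * ζ⁻¹) ^ k) {k : ℕ} (hk0 : 0 < k)
    (hk : k < 2 * m) : a k = -e ^ k * a (2 * m - k) := by
  have hζ0 : ζ ≠ 0 := hζ.ne_zero hN.ne'
  have heK : (e : K) ^ 2 = 1 := by exact_mod_cast he
  let c : ℕ → ℤ := fun k => if k = 0 then 0 else a k + e ^ k * a (2 * m - k)
  have hc : ∑ k ∈ Finset.range N.totient, (c k : K) * ζ ^ k = 0 := by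
    rw [hm]
    obtain ⟨M, hM⟩ : ∃ M, 2 * m = M + 1 := ⟨2 * m - 1, by omega⟩
    rw [hM] at ha hpow ⊢
    rw [Finset.sum_range_succ', Finset.sum_range_succ' _ M] at ha
    simp only [pow_zero, add_left_inj] at ha
    rw [← sub_eq_zero, ← Finset.sum_range_reflect (fun k => (a (k + 1) : K) * (e * ζ⁻¹) ^ (k + 1)),
      ← Finset.sum_sub_distrib] at ha
    rw [Finset.sum_range_succ', ← ha]
    simp only [c, if_true, Int.cast_zero, zero_mul, add_zero]
    refine Finset.sum_congr rfl fun i hi => ?_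
    have hi' := Finset.mem_range.1 hi
    have h1 : M - 1 - i + 1 = M + 1 - (i + 1) := by omega
    rw [if_neg (Nat.succ_ne_zero i), h1, hM]
    have h2 : (e * ζ⁻¹ : K) ^ (M + 1 - (i + 1)) = -(e ^ (i + 1) * ζ ^ (i + 1)) := by
      have h3 : (e * ζ⁻¹ : K) ^ (M + 1 - (i + 1)) * (e * ζ⁻¹) ^ (i + 1) = -1 := by
        rw [← pow_add, show M + 1 - (i + 1) + (i + 1) = M + 1 by omega, mul_pow, inv_pow, hpow,
          ← hM, pow_mul, heK]
        simp
      have h4 : (e * ζ⁻¹ : K) ^ (i + 1) * (e ^ (i + 1) * ζ ^ (i + 1)) = 1 := by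
        rw [← mul_pow, ← mul_pow, show (e * ζ⁻¹ * (e * ζ) : K) = e ^ 2 * (ζ⁻¹ * ζ) by ring, heK,
          inv_mul_cancel₀ hζ0, mul_one, one_pow]
      linear_combination (e ^ (i + 1) * ζ ^ (i + 1)) * h3 -
        (e * ζ⁻¹ : K) ^ (M + 1 - (i + 1)) * h4
    rw [h2]
    push_cast
    ring
  have h := hζ.eq_zero_of_sum_pow_eq_zero hN hc (hm ▸ hk)
  simp only [c, if_neg hk0.ne'] at h
  linear_combination h

/-- If `ζ` is a primitive `4 * m`-th root of unity, so is `-ζ⁻¹`. -/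
theorem IsPrimitiveRoot.neg_inv_of_pow_eq_neg_one {K : Type*} [Field K] {m : ℕ} {ζ : K}
    (hm : 0 < m) (hζ : IsPrimitiveRoot ζ (4 * m)) (hpow : ζ ^ (2 * m) = -1) :
    IsPrimitiveRoot (-ζ⁻¹) (4 * m) := by
  have hζ0 : ζ ≠ 0 := hζ.ne_zero (by omega)
  have h : -ζ⁻¹ = ζ ^ (2 * m - 1) := by
    rw [← mul_left_inj' hζ0, ← pow_succ, show 2 * m - 1 + 1 = 2 * m by omega, hpow]
    simp [hζ0]
  rw [h]
  refine hζ.pow_of_coprime _ ?_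
  obtain ⟨j, rfl⟩ : ∃ j, m = j + 1 := ⟨m - 1, by omega⟩
  have h1 : Nat.Coprime (2 * (j + 1) - 1) 2 := by
    rw [Nat.coprime_two_right, show 2 * (j + 1) - 1 = 2 * j + 1 by omega]
    exact odd_two_mul_add_one j
  have h2 : Nat.Coprime (2 * (j + 1) - 1) (2 * (j + 1)) := by
    rw [show 2 * (j + 1) = (2 * (j + 1) - 1) + 1 by omega, Nat.add_sub_cancel]
    exact Nat.coprime_self_add_right.2 (Nat.coprime_one_right _)
  rw [show 4 * (j + 1) = 2 * (2 * (j + 1)) by ring]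
  exact h1.mul_right h2

/-- For `n ≥ 3`, a primitive `2^n`-th root of unity `ζ` and a sign
`ε = ±1`, the ring of integers of `K = ℚ(ζ + ε·ζ̄)` is generated as an abelian group by
`1` and the elements `ζ^k + (ε·ζ̄)^k`, `k = 1, …, 2^(n-2) - 1`. -/
theorem ringOfIntIn_real_two_pow_generators (n : ℕ) (hn : 3 ≤ n) (ζ : ℂ)
    (hζ : IsPrimitiveRoot ζ (2 ^ n)) (ε : ℂ) (hε : ε = 1 ∨ ε = -1) :
    (ringOfIntIn (Subfield.closure {ζ + ε * ζ⁻¹})).toAddSubgroup =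
      AddSubgroup.closure
        ({1} ∪ {x : ℂ | ∃ k : ℕ, 1 ≤ k ∧ k ≤ 2 ^ (n - 2) - 1 ∧
          x = ζ ^ k + (ε * ζ⁻¹) ^ k}) := by
  have he : ∃ e : ℤ, e ^ 2 = 1 ∧ ε = e := by
    rcases hε with rfl | rfl
    exacts [⟨1, by norm_num⟩, ⟨-1, by norm_num⟩]
  obtain ⟨e, he, rfl⟩ := he
  have heC : (e : ℂ) ^ 2 = 1 := by exact_mod_cast he
  obtain ⟨r, rfl⟩ : ∃ r, n = r + 3 := ⟨n - 3, by omega⟩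
  obtain ⟨g, hg⟩ : ∃ g, 2 ^ (r + 1) = g + 1 := Nat.exists_eq_add_one.2 (Nat.two_pow_pos _)
  have hgeven : Even (g + 1) := hg ▸ (by simp [Nat.even_pow])
  have hN : 2 ^ (r + 3) = 4 * (g + 1) := by rw [← hg]; ring
  have htot : (2 ^ (r + 3)).totient = 2 * (g + 1) := by
    rw [Nat.totient_prime_pow_succ Nat.prime_two, ← hg]
    ring
  have hNpos : 0 < 2 ^ (r + 3) := by positivity
  have hζ0 : ζ ≠ 0 := hζ.ne_zero hNpos.ne'
  have hpow : ζ ^ (2 * (g + 1)) = -1 :=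
    (hζ.pow hNpos (by rw [hN]; ring)).eq_neg_one_of_two_right
  set η : ℂ := e * ζ⁻¹ with hη
  have hηprim : IsPrimitiveRoot η (2 ^ (r + 3)) := by
    rcases hε with h | h
    · simpa [hη, h] using hζ.inv
    · rw [hN] at hζ ⊢
      simpa [hη, h] using hζ.neg_inv_of_pow_eq_neg_one g.succ_pos hpow
  have hmul : ζ * η = e := by rw [hη]; field_simp
  have hζint : IsIntegral ℤ ζ := hζ.isIntegral hNpos
  have hηint : IsIntegral ℤ η := hηprim.isIntegral hNpos
  rw [show r + 3 - 2 = r + 1 by omega, hg, Nat.add_sub_cancel]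
  apply le_antisymm
  · rintro x ⟨hxint, hxK⟩
    obtain ⟨q, hq⟩ := exists_aeval_eq_of_mem_subfield_closure
      ((hζint.add hηint).tower_top (A := ℚ)).isAlgebraic hxK
    have hζF := IntermediateField.mem_adjoin_simple_self ℚ ζ
    have hηF : η ∈ IntermediateField.adjoin ℚ {ζ} :=
      mul_mem (intCast_mem _ e) (inv_mem hζF)
    have hxF : x ∈ IntermediateField.adjoin ℚ {ζ} := by
      have hle : Subfield.closure {ζ + η} ≤ (IntermediateField.adjoin ℚ {ζ}).toSubfield :=
        Subfield.closure_le.2 (Set.singleton_subset_iff.2 (add_mem hζF hηF))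
      exact hle hxK
    obtain ⟨a, ha⟩ := hζ.exists_int_sum_pow_of_isIntegral hxint hxF
    rw [htot] at ha
    have hconj : x = ∑ k ∈ Finset.range (2 * (g + 1)), (a k : ℂ) * η ^ k := by
      let p : Polynomial ℚ := ∑ k ∈ Finset.range (2 * (g + 1)),
        Polynomial.C (a k : ℚ) * Polynomial.X ^ k -
          q.comp (Polynomial.X + Polynomial.C (e : ℚ) * Polynomial.X ^ (2 ^ (r + 3) - 1))
      have hinv : ∀ {z w : ℂ}, IsPrimitiveRoot z (2 ^ (r + 3)) → z * w = e →
          e * z ^ (2 ^ (r + 3) - 1) = w := by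
        intro z w hz hzw
        rw [← hzw, mul_right_comm, ← pow_succ', Nat.sub_add_cancel hNpos, hz.pow_eq_one, one_mul]
      have hp : ∀ {z w : ℂ}, IsPrimitiveRoot z (2 ^ (r + 3)) → z * w = e → z + w = ζ + η →
          Polynomial.aeval z p =
            ∑ k ∈ Finset.range (2 * (g + 1)), (a k : ℂ) * z ^ k - x := by
        intro z w hz hzw hsum
        simp [p, Polynomial.aeval_comp, hinv hz hzw, hsum, hq]
      have h0 := hζ.aeval_rat_eq_zero hNpos hηprim (p := p)
        (by rw [hp hζ hmul rfl, ← ha, sub_self])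
      rw [hp hηprim (by rw [mul_comm, hmul]) (add_comm η ζ)] at h0
      exact (sub_eq_zero.1 h0).symm
    have hcoeff : ∀ {k : ℕ}, 0 < k → k < 2 * (g + 1) →
        a k = -e ^ k * a (2 * (g + 1) - k) := fun hk0 hk =>
      hζ.coeff_eq_neg_of_sum_eq hNpos htot hpow he (ha.symm.trans hconj) hk0 hk
    have hmid : a (g + 1) = 0 := by
      have h := hcoeff (k := g + 1) g.succ_pos (by omega)
      obtain ⟨j, hj⟩ := even_iff_two_dvd.1 hgeven
      rw [show 2 * (g + 1) - (g + 1) = g + 1 by omega,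
        show e ^ (g + 1) = 1 by rw [hj, pow_mul, he, one_pow]] at h
      omega
    rw [ha, sum_range_eq_add_sum_pow_add_pow (w := η) (a := fun k => (a k : ℂ))
      (by simp [hmid]) ?_]
    · refine add_mem ?_ (sum_mem fun i hi => ?_)
      · rw [← mul_one (a 0 : ℂ), ← zsmul_eq_mul]
        refine zsmul_mem ?_ _
        apply AddSubgroup.subset_closure
        exact Or.inl rfl
      · rw [← zsmul_eq_mul]
        refine zsmul_mem ?_ _
        apply AddSubgroup.subset_closure
        exact Or.inr ⟨i + 1, Nat.le_add_left 1 i, Finset.mem_range.1 hi, rfl⟩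
    · intro i hi
      have h1 : (a (i + 1) : ℂ) = -e ^ (i + 1) * a (2 * g + 1 - i) := by
        rw [hcoeff (k := i + 1) i.succ_pos (by omega), show 2 * (g + 1) - (i + 1) = 2 * g + 1 - i by omega]
        push_cast
        ring
      have h2 : ζ ^ (2 * g + 1 - i) * ζ ^ (i + 1) = -1 := by
        rw [← pow_add, show 2 * g + 1 - i + (i + 1) = 2 * (g + 1) by omega, hpow]
      have h3 : ζ ^ (i + 1) * η ^ (i + 1) = e ^ (i + 1) := by rw [← mul_pow, hmul]
      have h4 : (e : ℂ) ^ (i + 1) * e ^ (i + 1) = 1 := by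
        rw [← mul_pow, ← sq, heC, one_pow]
      have h5 : ζ ^ (2 * g + 1 - i) = -e ^ (i + 1) * η ^ (i + 1) := by
        linear_combination (-ζ ^ (2 * g + 1 - i)) * h4 + (e ^ (i + 1) * η ^ (i + 1)) * h2 -
          (e ^ (i + 1) * ζ ^ (2 * g + 1 - i)) * h3
      rw [h1, h5]
      ring
  · refine (AddSubgroup.closure_le _).2 ?_
    have hmem : ∀ k, ζ ^ k + η ^ k ∈ ringOfIntIn (Subfield.closure {ζ + η}) := by
      refine Subring.pow_add_pow_mem _ ⟨hζint.add hηint, ?_⟩ ?_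
      · exact Subfield.subset_closure rfl
      · rw [hmul]
        exact intCast_mem _ e
    rintro x (rfl | ⟨k, -, -, rfl⟩)
    exacts [one_mem (ringOfIntIn _), hmem k]
end

section
/- For every finite group G there exists a natural number e such that |G|^e · ℤ_{ℚ(G)} ⊆ ℤ[G]. -/
open CategoryTheory Module Pointwise
open scoped MatrixGroups

lemma Module.End.exists_trace_pow_eq_sum {V : Type*} [AddCommGroup V] [Module ℂ V]
    [FiniteDimensional ℂ V] {n : ℕ} (hn : 0 < n) {f : Module.End ℂ V} (hf : f ^ n = 1) :
    ∃ (s : Finset ℂ) (m : ℂ → ℕ), (∀ μ ∈ s, μ ^ n = 1) ∧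
      ∀ k : ℕ, LinearMap.trace ℂ V (f ^ k) = ∑ μ ∈ s, (m μ : ℂ) * μ ^ k := by
  classical
  have hss : f.IsSemisimple := by
    refine Module.End.isSemisimple_of_squarefree_aeval_eq_zero
      (p := Polynomial.X ^ n - 1) ?_ (by simp [hf])
    exact (Polynomial.separable_X_pow_sub_C (1 : ℂ) (by exact_mod_cast hn.ne')
      one_ne_zero).squarefree
  have hint : DirectSum.IsInternal f.eigenspace := by
    rw [DirectSum.isInternal_submodule_iff_iSupIndep_and_iSup_eq_top]
    refine ⟨f.eigenspaces_iSupIndep, ?_⟩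
    rw [← Module.End.iSup_maxGenEigenspace_eq_top f]
    exact iSup_congr fun μ ↦ (hss.isFinitelySemisimple.maxGenEigenspace_eq_eigenspace μ).symm
  have hfin : {μ | f.eigenspace μ ≠ ⊥}.Finite :=
    WellFoundedGT.finite_ne_bot_of_iSupIndep f.eigenspaces_iSupIndep
  have hpow (k : ℕ) {μ : ℂ} {v : V} (hv : v ∈ f.eigenspace μ) : (f ^ k) v = μ ^ k • v := by
    rw [Module.End.mem_eigenspace_iff] at hv
    induction k with
    | zero => simp
    | succ k ih => rw [pow_succ, Module.End.mul_apply, hv, map_smul, ih, smul_smul, pow_succ']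
  refine ⟨hfin.toFinset, fun μ ↦ finrank ℂ (f.eigenspace μ), fun μ hμ ↦ ?_, fun k ↦ ?_⟩
  · obtain ⟨v, hv, hv0⟩ := Submodule.exists_mem_ne_zero_of_ne_bot (hfin.mem_toFinset.mp hμ)
    have h := hpow n hv
    rw [hf, Module.End.one_apply] at h
    exact smul_left_injective ℂ hv0 (by simpa using h.symm)
  · have hmaps (μ : ℂ) : Set.MapsTo (f ^ k) (f.eigenspace μ) (f.eigenspace μ) := fun v hv ↦ by
      rw [SetLike.mem_coe, hpow k hv]
      exact Submodule.smul_mem _ _ hv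
    rw [LinearMap.trace_eq_sum_trace_restrict' hint hfin hmaps]
    refine Finset.sum_congr rfl fun μ _ ↦ ?_
    have : (f ^ k).restrict (hmaps μ) = μ ^ k • LinearMap.id := by
      refine LinearMap.ext fun v ↦ Subtype.ext ?_
      exact hpow k v.2
    rw [this, map_smul, LinearMap.trace_id, smul_eq_mul, mul_comm]

lemma FDRep.exists_character_pow_eq_sum {G : Type} [Group G] [Finite G] (V : FDRep ℂ G) (g : G) :
    ∃ (s : Finset ℂ) (m : ℂ → ℕ), (∀ μ ∈ s, μ ^ Nat.card G = 1) ∧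
      ∀ k : ℕ, V.character (g ^ k) = ∑ μ ∈ s, (m μ : ℂ) * μ ^ k := by
  simpa only [FDRep.character, map_pow] using Module.End.exists_trace_pow_eq_sum Nat.card_pos
    (f := V.ρ g) (by rw [← map_pow, pow_card_eq_one', map_one])

lemma Representation.simple_fdRep_of {G : Type} [Group G] [Finite G] {W : Type} [AddCommGroup W]
    [Module ℂ W] [FiniteDimensional ℂ W] (ρ : Representation ℂ G W) [ρ.IsIrreducible] :
    Simple (FDRep.of ρ) := by
  have := Fintype.ofFinite G
  have : Invertible (Nat.card G : ℂ) := invertibleOfNonzero (by simp)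
  rw [FDRep.simple_iff_char_is_norm_one]
  have h := ρ.card_inv_mul_sum_char_mul_char_eq_finrank ρ
  rw [IsIrreducible.finrank_intertwiningMap_self, Nat.cast_one,
    inv_mul_eq_one₀ (by simp)] at h
  exact h.symm

lemma Representation.asAlgebraHom_eq_zero_of_central {G : Type} [Group G] {W : Type}
    [AddCommGroup W] [Module ℂ W] [FiniteDimensional ℂ W] (ρ : Representation ℂ G W)
    [ρ.IsIrreducible] {z : MonoidAlgebra ℂ G} (hz : ∀ r, r * z = z * r)
    (htr : LinearMap.trace ℂ W (ρ.asAlgebraHom z) = 0) : ρ.asAlgebraHom z = 0 := by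
  have hcomm (g : G) : ρ.asAlgebraHom z ∘ₗ ρ g = ρ g ∘ₗ ρ.asAlgebraHom z := by
    rw [← ρ.asAlgebraHom_single_one g, ← Module.End.mul_eq_comp, ← Module.End.mul_eq_comp,
      ← map_mul, ← map_mul, hz]
  obtain ⟨c, hc⟩ := (IsIrreducible.algebraMap_intertwiningMap_bijective_of_isAlgClosed
    (ρ := ρ)).2 ⟨ρ.asAlgebraHom z, hcomm⟩
  have hc' : ρ.asAlgebraHom z = c • LinearMap.id :=
    (congrArg IntertwiningMap.toLinearMap hc).symm
  have : Nontrivial W := IsSimpleModule.nontrivial (MonoidAlgebra ℂ G) ρ.asModule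
  rw [hc', map_smul, LinearMap.trace_id, smul_eq_mul, mul_eq_zero] at htr
  rw [hc', htr.resolve_right (by exact_mod_cast finrank_pos.ne'), zero_smul]

lemma MonoidAlgebra.smul_eq_zero_of_central {G : Type} [Group G] [Finite G] {M : Type}
    [AddCommGroup M] [Module ℂ M] [Module (MonoidAlgebra ℂ G) M]
    [IsScalarTower ℂ (MonoidAlgebra ℂ G) M] [IsSimpleModule (MonoidAlgebra ℂ G) M]
    {z : MonoidAlgebra ℂ G} (hz : ∀ r, r * z = z * r)
    (horth : ∀ V : FDRep ℂ G, Simple V →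
      LinearMap.trace ℂ V (Representation.asAlgebraHom V.ρ z) = 0) (m : M) : z • m = 0 := by
  let ρ : Representation ℂ G M :=
    (Algebra.lsmul ℂ ℂ M : MonoidAlgebra ℂ G →ₐ[ℂ] Module.End ℂ M).toMonoidHom.comp
      (MonoidAlgebra.of ℂ G)
  have hρ : ρ.asAlgebraHom = Algebra.lsmul ℂ ℂ M := by
    ext g
    simp [ρ]
  have : FiniteDimensional ℂ M := Module.Finite.trans (MonoidAlgebra ℂ G) M
  let e : ρ.asModule ≃ₗ[MonoidAlgebra ℂ G] M :=
    { ρ.asModuleEquiv.toAddEquiv with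
      map_smul' := fun r x ↦ by
        change ρ.asModuleEquiv (r • x) = r • ρ.asModuleEquiv x
        rw [Representation.asModuleEquiv_map_smul, hρ, Algebra.lsmul_coe] }
  have : ρ.IsIrreducible := by
    rw [Representation.irreducible_iff_isSimpleModule_asModule]
    exact IsSimpleModule.congr e
  have h0 := ρ.asAlgebraHom_eq_zero_of_central hz (horth _ ρ.simple_fdRep_of)
  simpa [hρ] using LinearMap.congr_fun h0 m

lemma classFunction_eq_zero_of_orthogonal {G : Type} [Group G] [Fintype G] {f : G → ℂ}
    (hf : ∀ g h, f (h * g * h⁻¹) = f g)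
    (horth : ∀ V : FDRep ℂ G, Simple V → ∑ g, f g * V.character g⁻¹ = 0) : f = 0 := by
  classical
  set z : MonoidAlgebra ℂ G := ∑ g, MonoidAlgebra.single g⁻¹ (f g) with hz
  have hcomm (g : G) : MonoidAlgebra.single g 1 * z = z * MonoidAlgebra.single g 1 := by
    simp only [hz, Finset.mul_sum, Finset.sum_mul, MonoidAlgebra.single_mul_single, one_mul,
      mul_one]
    refine Fintype.sum_equiv (MulAut.conj g).toEquiv _ _ fun x ↦ ?_
    simp [hf, ← mul_assoc]
  have hcent (r : MonoidAlgebra ℂ G) : r * z = z * r := by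
    induction r using MonoidAlgebra.induction_linear with
    | zero => simp
    | add a b ha hb => rw [add_mul, mul_add, ha, hb]
    | single g c =>
      have : MonoidAlgebra.single g c = c • MonoidAlgebra.single g (1 : ℂ) := by simp
      rw [this, smul_mul_assoc, hcomm, mul_smul_comm]
  suffices hz0 : z = 0 by
    funext g
    have := congrArg (fun r : MonoidAlgebra ℂ G ↦ r.coeff g⁻¹) hz0
    simpa [hz, Finsupp.single_apply] using this
  rw [← Ideal.mem_bot, ← IsSemisimpleRing.jacobson_eq_bot, Ring.jacobson, Module.jacobson,
    Submodule.mem_sInf]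
  intro I hI
  have hsimple : IsSimpleModule (MonoidAlgebra ℂ G) (MonoidAlgebra ℂ G ⧸ I) :=
    isSimpleModule_iff_isCoatom.mpr hI
  have h := MonoidAlgebra.smul_eq_zero_of_central hcent (fun V hV ↦ by
    simpa [hz, FDRep.character] using horth V hV)
    (Submodule.Quotient.mk 1 : MonoidAlgebra ℂ G ⧸ I)
  rwa [← Submodule.Quotient.mk_smul, smul_eq_mul, mul_one, Submodule.Quotient.mk_eq_zero] at h

lemma FDRep.exists_column_orthogonality (G : Type) [Group G] [Finite G] :
    ∃ (ι : Type) (_ : Fintype ι) (V : ι → FDRep ℂ G), (∀ i, Simple (V i)) ∧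
      ∀ g, ∃ b : ι → ℂ, (∀ i, b i ∈ charRing G) ∧
        (∀ h, IsConj g h → ∑ i, (V i).character h * b i = Nat.card G) ∧
        ∀ h, ¬ IsConj g h → ∑ i, (V i).character h * b i = 0 := by
  classical
  have := Fintype.ofFinite G
  have hcard : (Nat.card G : ℂ) ≠ 0 := by simp
  have : Invertible (Nat.card G : ℂ) := invertibleOfNonzero hcard
  let T : Set (G → ℂ) := {φ | ∃ V : FDRep ℂ G, Simple V ∧ V.character = φ}
  choose V hV hVT using fun φ : T ↦ φ.2
  have hself (V : FDRep ℂ G) (hV : Simple V) :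
      ∑ x, V.character x * V.character x⁻¹ = (Nat.card G : ℂ) :=
    (FDRep.simple_iff_char_is_norm_one V).mp hV
  have horth (φ ψ : T) : ∑ x, (V φ).character x * (V ψ).character x⁻¹ =
      if φ = ψ then (Nat.card G : ℂ) else 0 := by
    split_ifs with heq
    · rw [heq, hself _ (hV ψ)]
    · have := hV φ
      have := hV ψ
      have h := FDRep.char_orthonormal (V φ) (V ψ)
      rw [inv_mul_eq_iff_eq_mul₀ hcard] at h
      rw [h, if_neg, mul_zero]
      exact fun ⟨i⟩ ↦ heq (Subtype.ext (by rw [← hVT φ, FDRep.char_iso i, hVT ψ]))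
  have hindep : LinearIndependent ℂ fun φ : T ↦ (V φ).character := by
    refine linearIndependent_iff'.mpr fun s c hc ψ hψ ↦ ?_
    have h0 : ∑ x, (∑ φ ∈ s, c φ * (V φ).character x) * (V ψ).character x⁻¹ = 0 :=
      Finset.sum_eq_zero fun x _ ↦ by
        have := congrFun hc x
        simp only [Finset.sum_apply, Pi.smul_apply, smul_eq_mul, Pi.zero_apply] at this
        rw [this, zero_mul]
    simp only [Finset.sum_mul, mul_assoc] at h0
    rw [Finset.sum_comm] at h0
    simpa [← Finset.mul_sum, horth, hψ] using h0
  have := hindep.finite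
  have := Fintype.ofFinite T
  refine ⟨T, inferInstance, V, hV, fun g ↦ ?_⟩
  let b : T → ℂ := fun φ ↦ ∑ x with IsConj g x, (V φ).character x⁻¹
  have key : (fun x ↦ (if IsConj g x then (Nat.card G : ℂ) else 0) -
      ∑ φ, (V φ).character x * b φ) = 0 := by
    refine classFunction_eq_zero_of_orthogonal (fun x h ↦ ?_) fun W hW ↦ ?_
    · have : IsConj g (h * x * h⁻¹) ↔ IsConj g x :=
        ⟨fun hx ↦ hx.trans (isConj_iff.mpr ⟨h, rfl⟩).symm,
          fun hx ↦ hx.trans (isConj_iff.mpr ⟨h, rfl⟩)⟩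
      simp only [this, FDRep.char_conj]
    · obtain ⟨ψ, hψ⟩ : ∃ ψ : T, W.character = (V ψ).character :=
        ⟨⟨_, W, hW, rfl⟩, (hVT ⟨_, W, hW, rfl⟩).symm⟩
      have h1 : ∑ x, (∑ φ, (V φ).character x * b φ) * (V ψ).character x⁻¹ =
          Nat.card G * b ψ := by
        simp only [Finset.sum_mul, mul_right_comm _ (b _)]
        rw [Finset.sum_comm]
        simp [← Finset.sum_mul, horth]
      simp only [hψ, sub_mul, Finset.sum_sub_distrib, h1]
      simp only [b, Finset.sum_filter, Finset.mul_sum, ← Finset.sum_sub_distrib]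
      exact Finset.sum_eq_zero fun x _ ↦ by split_ifs <;> simp
  refine ⟨b, fun φ ↦ sum_mem fun x _ ↦ Subring.subset_closure ⟨V φ, hV φ, _, rfl⟩,
    fun h hh ↦ ?_, fun h hh ↦ ?_⟩ <;>
  · have := congrFun key h
    simp only [hh, if_true, if_false, Pi.zero_apply, sub_eq_zero] at this
    exact this.symm

lemma FDRep.exists_character_pow {G : Type} [Group G] [Finite G] {K : IntermediateField ℚ ℂ}
    (σ : K →ₐ[ℚ] ℂ) {ζ : ℂ} (hζ : IsPrimitiveRoot ζ (Nat.card G))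
    (hK : K ≤ IntermediateField.adjoin ℚ {ζ}) :
    ∃ k : ℕ, ∀ (V : FDRep ℂ G) (g : G) (h : V.character g ∈ K),
      σ ⟨V.character g, h⟩ = V.character (g ^ k) := by
  have hpos : 0 < Nat.card G := Nat.card_pos
  have : NeZero (Nat.card G) := ⟨hpos.ne'⟩
  obtain ⟨τ, hτ⟩ := IntermediateField.exists_algHom_adjoin_of_splits (S := {ζ})
    (fun s hs ↦ ⟨hs ▸ (hζ.isIntegral hpos).tower_top, IsAlgClosed.splits _⟩) σ hK
  obtain ⟨k, -, hk⟩ := hζ.eq_pow_of_pow_eq_one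
    (ξ := τ (IntermediateField.AdjoinSimple.gen ℚ ζ)) (by
      rw [← map_pow, ← map_one τ]
      exact congrArg τ (Subtype.ext hζ.pow_eq_one))
  refine ⟨k, fun V g h ↦ ?_⟩
  obtain ⟨s, m, hs, hm⟩ := V.exists_character_pow_eq_sum g
  have hroot (μ : ℂ) (hμ : μ ∈ s) : ∃ ν : IntermediateField.adjoin ℚ {ζ},
      (ν : ℂ) = μ ∧ τ ν = μ ^ k := by
    obtain ⟨i, -, rfl⟩ := hζ.eq_pow_of_pow_eq_one (hs μ hμ)
    refine ⟨IntermediateField.AdjoinSimple.gen ℚ ζ ^ i, rfl, ?_⟩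
    rw [map_pow, ← hk, ← pow_mul, ← pow_mul, mul_comm]
  choose! ν hν hτν using hroot
  have hσ : σ ⟨V.character g, h⟩ = τ ⟨V.character g, hK h⟩ := (DFunLike.congr_fun hτ _).symm
  have hchar : (⟨V.character g, hK h⟩ : IntermediateField.adjoin ℚ {ζ}) =
      ∑ μ ∈ s, (m μ : _) * ν μ := by
    apply Subtype.ext
    have := hm 1
    simp only [pow_one] at this
    push_cast
    exact this.trans (Finset.sum_congr rfl fun μ hμ ↦ by rw [hν μ hμ])
  rw [hσ, hchar, map_sum]
  rw [hm]
  exact Finset.sum_congr rfl fun μ hμ ↦ by rw [map_mul, map_natCast, hτν μ hμ]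

lemma charValues_subset_adjoin {G : Type} [Group G] [Finite G] {ζ : ℂ}
    (hζ : IsPrimitiveRoot ζ (Nat.card G)) :
    charValues G ⊆ IntermediateField.adjoin ℚ {ζ} := by
  rintro _ ⟨V, -, g, rfl⟩
  have : NeZero (Nat.card G) := ⟨Nat.card_pos.ne'⟩
  obtain ⟨s, m, hs, hm⟩ := V.exists_character_pow_eq_sum g
  have h := hm 1
  simp only [pow_one] at h
  rw [SetLike.mem_coe, h]
  refine sum_mem fun μ hμ ↦ mul_mem (natCast_mem _ _) ?_
  obtain ⟨i, -, rfl⟩ := hζ.eq_pow_of_pow_eq_one (hs μ hμ)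
  exact pow_mem (IntermediateField.mem_adjoin_simple_self ℚ ζ) i

lemma isIntegral_of_mem_charValues {G : Type} [Group G] [Finite G] {z : ℂ}
    (hz : z ∈ charValues G) : IsIntegral ℤ z := by
  obtain ⟨V, -, g, rfl⟩ := hz
  obtain ⟨s, m, hs, hm⟩ := V.exists_character_pow_eq_sum g
  have h := hm 1
  simp only [pow_one] at h
  rw [h]
  refine IsIntegral.sum _ fun μ hμ ↦ (isIntegral_natCast _).mul (.of_pow (n := Nat.card G) Nat.card_pos ?_)
  rw [hs μ hμ]
  exact isIntegral_one

lemma sum_embeddings_mem_subring {K : Type*} [Field K] [NumberField K] {y : K}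
    (hy : IsIntegral ℤ y) (R : Subring ℂ) : ∑ σ : K →ₐ[ℚ] ℂ, σ y ∈ R := by
  rw [← trace_eq_sum_embeddings ℂ]
  obtain ⟨m, hm⟩ := IsIntegrallyClosed.isIntegral_iff.mp (Algebra.isIntegral_trace (L := ℚ) hy)
  rw [← hm]
  simp

/-- For every finite group `G` there is `e ∈ ℕ` with
`|G|^e · ℤ_{ℚ(G)} ⊆ ℤ[G]`. -/
theorem exists_pow_card_mul_ringOfIntIn_subset_charRing (G : Type) [Group G] [Finite G] :
    ∃ e : ℕ, ∀ x ∈ ringOfIntIn (charField G),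
      (Nat.card G : ℂ) ^ e * x ∈ charRing G := by
  classical
  have := Fintype.ofFinite G
  obtain ⟨ι, _, V, hV, hcol⟩ := FDRep.exists_column_orthogonality G
  choose b hb hbconj hbnot using hcol
  have hpos : 0 < Nat.card G := Nat.card_pos
  have hζ := Complex.isPrimitiveRoot_exp (Nat.card G) hpos.ne'
  set ζ := Complex.exp (2 * Real.pi * Complex.I / Nat.card G)
  let K : IntermediateField ℚ ℂ := IntermediateField.adjoin ℚ (charValues G)
  have hKζ : K ≤ IntermediateField.adjoin ℚ {ζ} :=
    IntermediateField.adjoin_le_iff.mpr (charValues_subset_adjoin hζ)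
  have hmemK {z : ℂ} (hz : z ∈ charValues G) : z ∈ K := IntermediateField.subset_adjoin _ _ hz
  have : FiniteDimensional ℚ (IntermediateField.adjoin ℚ {ζ}) :=
    IntermediateField.adjoin.finiteDimensional (hζ.isIntegral hpos).tower_top
  have : FiniteDimensional ℚ K := Module.Finite.of_injective
    (IntermediateField.inclusion hKζ).toLinearMap (IntermediateField.inclusion hKζ).injective
  have : NumberField K := { to_charZero := inferInstance, to_finiteDimensional := this }
  let a (i : ι) (g : G) : K := ⟨(V i).character g, hmemK ⟨V i, hV i, g, rfl⟩⟩
  have ha (i : ι) (g : G) : IsIntegral ℤ (a i g) :=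
    (isIntegral_algebraMap_iff (algebraMap K ℂ).injective).mp
      (isIntegral_of_mem_charValues ⟨V i, hV i, g, rfl⟩)
  refine ⟨Fintype.card G, fun x ⟨hxint, hxK⟩ ↦ ?_⟩
  have hxK' : x ∈ K := by
    have : charField G ≤ K.toSubfield := Subfield.closure_le.mpr fun z hz ↦ hmemK hz
    exact this hxK
  let X : K := ⟨x, hxK'⟩
  have hX : IsIntegral ℤ X :=
    (isIntegral_algebraMap_iff (algebraMap K ℂ).injective).mp hxint
  let σ₀ : K →ₐ[ℚ] ℂ := Algebra.ofId K ℂ |>.restrictScalars ℚ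
  have hprod (σ : K →ₐ[ℚ] ℂ) : σ X * ∏ g, ∑ i, σ (a i g) * b g i =
      if σ = σ₀ then (Nat.card G : ℂ) ^ Fintype.card G * x else 0 := by
    split_ifs with h
    · have hone (g : G) : ∑ i, σ (a i g) * b g i = Nat.card G := by
        rw [h]
        exact hbconj g g (IsConj.refl g)
      rw [Finset.prod_congr rfl fun g _ ↦ hone g, Finset.prod_const, Finset.card_univ, h, mul_comm]
      rfl
    · obtain ⟨k, hk⟩ := FDRep.exists_character_pow σ hζ hKζ
      obtain ⟨g, hg⟩ : ∃ g : G, ¬ IsConj g (g ^ k) := by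
        by_contra! hconj
        refine h (IntermediateField.algHom_ext_of_eq_adjoin ℚ (S := K) rfl ?_)
        rintro _ ⟨W, hW, g, rfl⟩
        obtain ⟨c, hc⟩ := isConj_iff.mp (hconj g)
        exact (hk W g _).trans (by rw [← hc, FDRep.char_conj]; rfl)
      rw [Finset.prod_eq_zero (Finset.mem_univ g), mul_zero]
      rw [← hbnot g _ hg]
      exact Finset.sum_congr rfl fun i _ ↦ by rw [hk]
  have hsum : (Nat.card G : ℂ) ^ Fintype.card G * x =
      ∑ p : G → ι, (∑ σ : K →ₐ[ℚ] ℂ, σ (X * ∏ g, a (p g) g)) * ∏ g, b g (p g) := by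
    rw [← Fintype.sum_ite_eq' σ₀ fun _ ↦ (Nat.card G : ℂ) ^ Fintype.card G * x]
    simp only [← hprod, Finset.prod_univ_sum, Fintype.piFinset_univ, Finset.prod_mul_distrib,
      Finset.mul_sum, Finset.sum_mul, map_mul, map_prod]
    rw [Finset.sum_comm]
    simp only [mul_assoc]
  rw [hsum]
  exact sum_mem fun p _ ↦ mul_mem
    (sum_embeddings_mem_subring (hX.mul (IsIntegral.prod _ fun g _ ↦ ha _ g)) _)
    (prod_mem fun g _ ↦ hb g _)
end

section
/- Let G be a finite nilpotent group of odd order, let p_1, …, p_n be the distinct prime divisors of |G|, and set q := ∏_{i=1}^n min{p_i^3, |G|_{p_i}}, where |G|_{p_i} is the p_i-part of |G|. Then |G| · ℤ_{ℚ(G)} ⊆ q · ℤ[G]. -/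
open CategoryTheory Module Pointwise
open scoped MatrixGroups

/-- The values of the character of an irreducible representation lie in `charValues`. -/
theorem trace_mem_charValues_of_isIrreducible {G : Type} [Group G] [Finite G] {V : Type}
    [AddCommGroup V] [Module ℂ V] [FiniteDimensional ℂ V] (ρ : Representation ℂ G V)
    [ρ.IsIrreducible] (g : G) : LinearMap.trace ℂ V (ρ g) ∈ charValues G := by
  have := Fintype.ofFinite G
  have hG : (Nat.card G : ℂ) ≠ 0 := Nat.cast_ne_zero.2 Nat.card_pos.ne'
  have : NeZero (Nat.card G : ℂ) := ⟨hG⟩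
  have := invertibleOfNonzero hG
  refine ⟨FDRep.of ρ, ?_, g, rfl⟩
  rw [FDRep.simple_iff_char_is_norm_one]
  have h := Representation.char_orthonormal ρ ρ
  rw [if_pos ⟨Representation.Equiv.refl ρ⟩, inv_mul_eq_one₀ hG] at h
  exact h.symm

/-- The values of the character of an arbitrary finite-dimensional representation lie in
`charRing`. -/
theorem trace_mem_charRing {G : Type} [Group G] [Finite G] (g : G) (n : ℕ) :
    ∀ {V : Type} [AddCommGroup V] [Module ℂ V] [FiniteDimensional ℂ V]
      (ρ : Representation ℂ G V), finrank ℂ V = n → LinearMap.trace ℂ V (ρ g) ∈ charRing G := by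
  have hG : (Nat.card G : ℂ) ≠ 0 := Nat.cast_ne_zero.2 Nat.card_pos.ne'
  have : NeZero (Nat.card G : ℂ) := ⟨hG⟩
  induction n using Nat.strong_induction_on with
  | _ n ih =>
    intro V _ _ _ ρ hV
    by_cases hirr : ρ.IsIrreducible
    · exact Subring.subset_closure (trace_mem_charValues_of_isIrreducible ρ g)
    rcases subsingleton_or_nontrivial V with hs | hs
    · have : LinearMap.trace ℂ V (ρ g) = 0 := by
        rw [Subsingleton.elim (ρ g) 0, map_zero]
      rw [this]
      exact zero_mem _
    have hnt : Nontrivial (Subrepresentation ρ) := by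
      refine ⟨⊥, ⊤, fun h => ?_⟩
      obtain ⟨v, hv⟩ := exists_ne (0 : V)
      have : v ∈ (⊥ : Subrepresentation ρ) := h ▸ Submodule.mem_top
      exact hv this
    obtain ⟨W, hW⟩ : ∃ W : Subrepresentation ρ, W ≠ ⊥ ∧ W ≠ ⊤ := by
      by_contra! hcon
      exact hirr ⟨fun W => or_iff_not_imp_left.2 (hcon W)⟩
    obtain ⟨U, hU⟩ := exists_isCompl W
    have hc : IsCompl W.toSubmodule U.toSubmodule := by
      refine IsCompl.of_eq ?_ ?_
      · exact congrArg Subrepresentation.toSubmodule hU.inf_eq_bot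
      · exact congrArg Subrepresentation.toSubmodule hU.sup_eq_top
    have hadd := Submodule.finrank_add_eq_of_isCompl hc
    have hWpos : 0 < finrank ℂ W.toSubmodule := by
      rw [Module.finrank_pos_iff_exists_ne_zero]
      by_contra! hcon
      apply hW.1
      apply Subrepresentation.toSubmodule_injective
      exact (Submodule.eq_bot_iff _).2 fun x hx => congrArg Subtype.val (hcon ⟨x, hx⟩)
    have hUpos : 0 < finrank ℂ U.toSubmodule := by
      rw [Nat.pos_iff_ne_zero]
      intro h0
      rw [h0, add_zero] at hadd
      exact hW.2 (Subrepresentation.toSubmodule_injective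
        (Submodule.eq_top_of_finrank_eq hadd))
    have htr : LinearMap.trace ℂ V (ρ g) =
        LinearMap.trace ℂ _ (W.toRepresentation g) + LinearMap.trace ℂ _ (U.toRepresentation g) := by
      let N : Bool → Submodule ℂ V := fun b => bif b then W.toSubmodule else U.toSubmodule
      have hN : DirectSum.IsInternal N :=
        (DirectSum.isInternal_submodule_iff_isCompl N (i := true) (j := false) (by simp)
          (by ext b; cases b <;> simp)).2 hc
      have hmap : ∀ b, Set.MapsTo (ρ g) (N b) (N b) := by
        rintro (_ | _)
        · exact fun v hv => U.apply_mem_toSubmodule g hv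
        · exact fun v hv => W.apply_mem_toSubmodule g hv
      rw [LinearMap.trace_eq_sum_trace_restrict hN hmap, Fintype.sum_bool]
      rfl
    rw [htr]
    exact add_mem (ih _ (by omega) _ rfl) (ih _ (by omega) _ rfl)

/-- Inflation along a surjective homomorphism. -/
theorem charRing_le_of_surjective {G P : Type} [Group G] [Finite G] [Group P] (f : G →* P)
    (hf : Function.Surjective f) : charRing P ≤ charRing G := by
  refine Subring.closure_le.2 ?_
  rintro z ⟨V, -, x, rfl⟩
  obtain ⟨g, rfl⟩ := hf x
  exact trace_mem_charRing g _ (V.ρ.comp f) rfl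

/-- The left translation action of `G` on the space of functions `G → ℂ`. -/
def translationRep (G : Type) [Group G] : Representation ℂ G (G → ℂ) where
  toFun g := LinearMap.funLeft ℂ ℂ fun x => g⁻¹ * x
  map_one' := by ext; simp [LinearMap.funLeft]
  map_mul' a b := by ext; simp [LinearMap.funLeft, mul_assoc]

theorem translationRep_apply {G : Type} [Group G] (g : G) (v : G → ℂ) (x : G) :
    translationRep G g v x = v (g⁻¹ * x) := rfl

/-- The representation induced from a linear character `l` of a subgroup `H`, realized as
functions on `G` that transform through `l` under right translation by `H`. -/
def monomialSubrep {G : Type} [Group G] (H : Subgroup G) (l : H →* ℂ) :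
    Subrepresentation (translationRep G) where
  toSubmodule :=
    { carrier := {v | ∀ (x : G) (h : H), l h * v (x * h) = v x}
      add_mem' := fun {v w} hv hw x h => by simp [mul_add, hv x h, hw x h]
      zero_mem' := fun x h => by simp
      smul_mem' := fun c v hv x h => by
        simp only [Pi.smul_apply, smul_eq_mul]
        rw [← hv x h]
        ring }
  apply_mem_toSubmodule g v hv x h := by
    simp only [translationRep_apply, ← mul_assoc]
    exact hv (g⁻¹ * x) h

/-- The averaging projection of `G → ℂ` onto the monomial representation attached to `l`. -/
noncomputable def monomialProj {G : Type} [Group G] (H : Subgroup G) [Fintype H]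
    (l : H →* ℂ) : (G → ℂ) →ₗ[ℂ] (G → ℂ) where
  toFun v x := (Nat.card H : ℂ)⁻¹ * ∑ h : H, l h * v (x * h)
  map_add' v w := by ext x; simp [mul_add, Finset.sum_add_distrib]
  map_smul' c v := by
    ext x
    simp only [Pi.smul_apply, smul_eq_mul, RingHom.id_apply, Finset.mul_sum]
    exact Finset.sum_congr rfl fun h _ => by ring

theorem monomialProj_apply {G : Type} [Group G] (H : Subgroup G) [Fintype H]
    (l : H →* ℂ) (v : G → ℂ) (x : G) :
    monomialProj H l v x = (Nat.card H : ℂ)⁻¹ * ∑ h : H, l h * v (x * h) := rfl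

theorem monomialProj_mem {G : Type} [Group G] (H : Subgroup G) [Fintype H] (l : H →* ℂ)
    (v : G → ℂ) : monomialProj H l v ∈ (monomialSubrep H l).toSubmodule := by
  intro x k
  simp only [monomialProj_apply]
  rw [mul_left_comm, Finset.mul_sum,
    ← Equiv.sum_comp (Equiv.mulLeft k) fun h : H => l h * v (x * h)]
  congr 1
  exact Finset.sum_congr rfl fun h _ => by simp [mul_assoc]

theorem monomialProj_of_mem {G : Type} [Group G] (H : Subgroup G) [Fintype H] (l : H →* ℂ)
    {v : G → ℂ} (hv : v ∈ (monomialSubrep H l).toSubmodule) : monomialProj H l v = v := by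
  ext x
  have hH : (Nat.card H : ℂ) ≠ 0 := Nat.cast_ne_zero.2 Nat.card_pos.ne'
  rw [monomialProj_apply, Finset.sum_congr rfl fun h _ => hv x h]
  simp only [Finset.sum_const, Finset.card_univ, nsmul_eq_mul, ← Nat.card_eq_fintype_card]
  rw [inv_mul_cancel_left₀ hH]

open Classical in
/-- The character formula for a representation induced from a linear character. -/
theorem trace_monomialSubrep {G : Type} [Group G] [Fintype G] (H : Subgroup G) (l : H →* ℂ)
    (g : G) : LinearMap.trace ℂ _ ((monomialSubrep H l).toRepresentation g) =
      (Nat.card H : ℂ)⁻¹ *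
        ∑ y : G, if hy : y⁻¹ * g * y ∈ H then l ⟨y⁻¹ * g * y, hy⟩ else 0 := by
  set F := translationRep G g ∘ₗ monomialProj H l with hF
  have hmem : ∀ v, F v ∈ (monomialSubrep H l).toSubmodule := fun v =>
    (monomialSubrep H l).apply_mem_toSubmodule g (monomialProj_mem H l v)
  have hres : (monomialSubrep H l).toRepresentation g = F.restrict fun v _ => hmem v := by
    ext1 ⟨v, hv⟩
    apply Subtype.ext
    change translationRep G g v = translationRep G g (monomialProj H l v)
    rw [monomialProj_of_mem H l hv]
  rw [hres, LinearMap.trace_restrict_eq_of_forall_mem _ _ hmem,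
    LinearMap.trace_eq_matrix_trace ℂ (Pi.basisFun ℂ G), Matrix.trace, Finset.mul_sum]
  refine Finset.sum_congr rfl fun y _ => ?_
  rw [Matrix.diag_apply, LinearMap.toMatrix_apply, Pi.basisFun_apply, Pi.basisFun_repr, hF,
    LinearMap.comp_apply, translationRep_apply, monomialProj_apply]
  congr 1
  split_ifs with hy
  · rw [Finset.sum_eq_single ⟨y⁻¹ * g * y, hy⟩]
    · simp [mul_assoc]
    · intro h _ hne
      rw [Pi.single_eq_of_ne, mul_zero]
      intro he
      apply hne
      apply Subtype.ext
      change (h : G) = y⁻¹ * g * y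
      rw [eq_inv_mul_of_mul_eq he]
      group
    · simp
  · refine Finset.sum_eq_zero fun h _ => ?_
    rw [Pi.single_eq_of_ne, mul_zero]
    intro he
    apply hy
    have : y⁻¹ * g * y = h := by
      rw [eq_inv_mul_of_mul_eq he]
      group
    exact this ▸ h.2

/-- If a linear character of `H` takes the value `z` at all conjugates of `g` in `H`, then a
multiple of `z` is a value of the induced character. -/
theorem mul_mem_charRing_of_induced {G : Type} [Group G] [Finite G] (H : Subgroup G)
    (l : H →* ℂ) (g : G) (z : ℂ) (hz : ∀ (y : G) (hy : y⁻¹ * g * y ∈ H), l ⟨y⁻¹ * g * y, hy⟩ = z)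
    (r : ℕ) (hr : Nat.card {y : G // y⁻¹ * g * y ∈ H} = r * Nat.card H) :
    (r : ℂ) * z ∈ charRing G := by
  classical
  have := Fintype.ofFinite G
  have hH : (Nat.card H : ℂ) ≠ 0 := Nat.cast_ne_zero.2 Nat.card_pos.ne'
  have h := trace_mem_charRing g _ (monomialSubrep H l).toRepresentation rfl
  rw [trace_monomialSubrep] at h
  convert h using 1
  rw [Finset.sum_congr rfl (g := fun y : G => if y⁻¹ * g * y ∈ H then z else 0)
    fun y _ => by split_ifs with hy <;> simp [hz], ← Finset.sum_filter, Finset.sum_const,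
    nsmul_eq_mul, ← Fintype.card_subtype, ← Nat.card_eq_fintype_card, hr]
  push_cast
  field_simp

theorem pow_dvd_pow_prime_pow_sub_one_iff {p : ℕ} (hp : p.Prime) (hodd : Odd p) {k : ℤ}
    (hk : (p : ℤ) ∣ k - 1) (i j : ℕ) :
    (p : ℤ) ^ (i + j) ∣ k ^ p ^ i - 1 ↔ (p : ℤ) ^ j ∣ k - 1 := by
  have : Fact p.Prime := ⟨hp⟩
  have hk' : ¬(p : ℤ) ∣ k := fun h => by
    have h1 : (p : ℤ) ∣ 1 := by simpa using dvd_sub h hk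
    exact hp.one_lt.ne' (by exact_mod_cast Int.eq_one_of_dvd_one (by positivity) h1)
  have h := Int.emultiplicity_pow_sub_pow hp hodd (y := 1) hk hk' (p ^ i)
  rw [one_pow, emultiplicity_pow_self hp.ne_zero hp.prime.not_isUnit] at h
  rw [pow_dvd_iff_le_emultiplicity, pow_dvd_iff_le_emultiplicity, h]
  push_cast
  rw [add_comm (i : ℕ∞)]
  exact ENat.add_le_add_iff_right (ENat.natCast_ne_top i)

/-- In a finite cyclic group the order of an element determines membership in the subgroup
generated by another element. -/
theorem mem_powers_of_orderOf_dvd {C : Type*} [Group C] [Finite C] [IsCyclic C] {a b : C}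
    (h : orderOf a ∣ orderOf b) : ∃ m : ℕ, b ^ m = a := by
  classical
  have := Fintype.ofFinite C
  have hsub : (Finset.univ.filter fun x : C => x ∈ Subgroup.zpowers b) ⊆
      Finset.univ.filter fun x : C => x ^ orderOf b = 1 := by
    intro x hx
    simp only [Finset.mem_filter, Finset.mem_univ, true_and] at hx ⊢
    exact orderOf_dvd_iff_pow_eq_one.1 (orderOf_dvd_of_mem_zpowers hx)
  have hcard : (Finset.univ.filter fun x : C => x ^ orderOf b = 1).card ≤
      (Finset.univ.filter fun x : C => x ∈ Subgroup.zpowers b).card := by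
    refine (IsCyclic.card_pow_eq_one_le (orderOf_pos b)).trans ?_
    rw [← Fintype.card_subtype, ← Nat.card_eq_fintype_card]
    exact (Nat.card_zpowers b).ge
  have heq := Finset.eq_of_subset_of_card_le hsub hcard
  have ha : a ∈ Finset.univ.filter fun x : C => x ^ orderOf b = 1 := by
    simp [orderOf_dvd_iff_pow_eq_one.1 h]
  rw [← heq] at ha
  simp only [Finset.mem_filter, Finset.mem_univ, true_and] at ha
  exact (isOfFinOrder_of_finite b).mem_powers_iff_mem_zpowers.2 ha

/-- For odd `p`, the powers of an integer `k ≡ 1 [MOD p]` with `k ≢ 1 [MOD p ^ (b + 1)]` exhaust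
the residue classes modulo `p ^ c` that are congruent to `1` modulo `p ^ b`. -/
theorem exists_pow_modEq {p : ℕ} (hp : p.Prime) (hodd : Odd p) {b c k k₀ : ℕ} (hb : 1 ≤ b)
    (hk : k ≡ 1 [MOD p]) (hkb : ¬k ≡ 1 [MOD p ^ (b + 1)]) (hk₀ : k₀ ≡ 1 [MOD p ^ b]) :
    ∃ m : ℕ, k ^ m ≡ k₀ [MOD p ^ c] := by
  have hcop : ∀ {l : ℕ}, l ≡ 1 [MOD p] → l.Coprime (p ^ c) := fun {l} hl => by
    apply Nat.Coprime.pow_right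
    rw [Nat.coprime_comm, hp.coprime_iff_not_dvd]
    intro hd
    have := hl.symm.trans (Nat.modEq_zero_iff_dvd.2 hd)
    have := Nat.modEq_zero_iff_dvd.1 this
    exact hp.one_lt.ne' (Nat.dvd_one.1 this)
  rcases le_or_gt c b with hcb | hcb
  · exact ⟨0, by simpa using (hk₀.of_dvd (pow_dvd_pow p hcb)).symm⟩
  have hk₀p : k₀ ≡ 1 [MOD p] := hk₀.of_dvd (dvd_pow_self p (by omega))
  have hdvd : ∀ {l n : ℕ}, l ≡ 1 [MOD p ^ n] ↔ (p : ℤ) ^ n ∣ (l : ℤ) - 1 := fun {l n} => by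
    rw [Nat.ModEq.comm, Nat.modEq_iff_dvd]
    push_cast
    rfl
  have hdvd1 : ∀ {l : ℕ}, l ≡ 1 [MOD p] → (p : ℤ) ∣ (l : ℤ) - 1 := fun {l} h => by
    simpa using hdvd (n := 1).1 (by simpa using h)
  have hunit : ∀ {l : ℕ} (h : l.Coprime (p ^ c)) (n : ℕ),
      ZMod.unitOfCoprime l h ^ n = 1 ↔ (p : ℤ) ^ c ∣ (l : ℤ) ^ n - 1 := fun {l} h n => by
    rw [Units.ext_iff, Units.val_pow_eq_pow_val, ZMod.coe_unitOfCoprime, Units.val_one,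
      ← Nat.cast_pow, ← Nat.cast_one, ZMod.natCast_eq_natCast_iff, hdvd]
    push_cast
    rfl
  have : NeZero (p ^ c) := ⟨pow_ne_zero _ hp.ne_zero⟩
  have := ZMod.isCyclic_units_of_prime_pow p hp (fun h => by subst h; exact absurd hodd (by decide)) c
  obtain ⟨m, hm⟩ := mem_powers_of_orderOf_dvd (a := ZMod.unitOfCoprime k₀ (hcop hk₀p))
    (b := ZMod.unitOfCoprime k (hcop hk)) (by
      have h0 : orderOf (ZMod.unitOfCoprime k₀ (hcop hk₀p)) ∣ p ^ (c - b) := by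
        rw [orderOf_dvd_iff_pow_eq_one, hunit]
        have := (pow_dvd_pow_prime_pow_sub_one_iff hp hodd (hdvd1 hk₀p) (c - b) b).2
          (hdvd.1 hk₀)
        rwa [Nat.sub_add_cancel hcb.le] at this
      have h1 : orderOf (ZMod.unitOfCoprime k (hcop hk)) ∣ p ^ (c - 1) := by
        rw [orderOf_dvd_iff_pow_eq_one, hunit]
        have := (pow_dvd_pow_prime_pow_sub_one_iff hp hodd (hdvd1 hk) (c - 1) 1).2
          (by simpa using hdvd1 hk)
        rwa [Nat.sub_add_cancel (by omega)] at this
      obtain ⟨s, -, hs⟩ := (Nat.dvd_prime_pow hp).1 h1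
      refine h0.trans (hs ▸ pow_dvd_pow p ?_)
      by_contra! hlt
      have h2 : orderOf (ZMod.unitOfCoprime k (hcop hk)) ∣ p ^ (c - (b + 1)) :=
        hs ▸ pow_dvd_pow p (by omega)
      rw [orderOf_dvd_iff_pow_eq_one, hunit] at h2
      have h3 := (pow_dvd_pow_prime_pow_sub_one_iff hp hodd (hdvd1 hk) (c - (b + 1)) (b + 1)).1
        (by rwa [Nat.sub_add_cancel (by omega)])
      exact hkb (hdvd.2 h3))
  refine ⟨m, ?_⟩
  rw [Units.ext_iff, Units.val_pow_eq_pow_val, ZMod.coe_unitOfCoprime, ZMod.coe_unitOfCoprime,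
    ← Nat.cast_pow, ZMod.natCast_eq_natCast_iff] at hm
  exact hm

/-- In a finite commutative group, every admissible root of unity is the value of a linear
character at a given element. -/
theorem exists_monoidHom_apply_eq {D : Type*} [Group D] [Finite D]
    (hcomm : ∀ a b : D, a * b = b * a) (g : D) {ζ : ℂ} (hζ : ζ ^ orderOf g = 1) :
    ∃ l : D →* ℂ, l g = ζ := by
  let _ : CommGroup D := { mul_comm := hcomm }
  have hu : IsUnit ζ := IsUnit.of_pow_eq_one hζ (orderOf_pos g).ne'
  obtain ⟨u, rfl⟩ := hu
  have hgen : ∀ x : Subgroup.zpowers g,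
      x ∈ Subgroup.zpowers (⟨g, Subgroup.mem_zpowers g⟩ : Subgroup.zpowers g) := by
    rintro ⟨x, k, rfl⟩
    exact ⟨k, rfl⟩
  have hord : orderOf u ∣ orderOf (⟨g, Subgroup.mem_zpowers g⟩ : Subgroup.zpowers g) := by
    rw [Subgroup.orderOf_mk]
    refine orderOf_dvd_of_pow_eq_one (Units.ext ?_)
    simpa using hζ
  obtain ⟨φ, hφ⟩ := MonoidHom.domRestrict_surjective ℂ (Subgroup.zpowers g)
    (monoidHomOfForallMemZpowers hgen hord)
  refine ⟨(Units.coeHom ℂ).comp φ, ?_⟩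
  have h := DFunLike.congr_fun hφ ⟨g, Subgroup.mem_zpowers g⟩
  rw [monoidHomOfForallMemZpowers_apply_gen] at h
  exact congrArg Units.val h

theorem mul_mem_charRing_of_conj {P : Type} [Group P] [Finite P] (D : Subgroup P)
    (hcomm : ∀ a b : D, a * b = b * a) {g : P} (hg : g ∈ D) {ζ : ℂ} {n : ℕ} (hζ : ζ ^ n = 1)
    (hn : n ∣ orderOf g) (hconj : ∀ y : P, y⁻¹ * g * y ∈ D → ∃ k, k ≡ 1 [MOD n] ∧ y⁻¹ * g * y = g ^ k)
    {r : ℕ} (hr : Nat.card {y : P // y⁻¹ * g * y ∈ D} = r * Nat.card D) :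
    (r : ℂ) * ζ ∈ charRing P := by
  obtain ⟨l, hl⟩ := exists_monoidHom_apply_eq hcomm ⟨g, hg⟩ (ζ := ζ) (by
    obtain ⟨c, hc⟩ := hn
    rw [Subgroup.orderOf_mk, hc, pow_mul, hζ, one_pow])
  refine mul_mem_charRing_of_induced D l g ζ (fun y hy => ?_) r hr
  obtain ⟨k, hk, h⟩ := hconj y hy
  have : (⟨y⁻¹ * g * y, hy⟩ : D) = ⟨g, hg⟩ ^ k := Subtype.ext h
  rw [this, map_pow, hl]
  obtain h1 | h1 := eq_or_ne n 0
  · subst h1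
    rw [Nat.modEq_zero_iff.1 hk, pow_one]
  · rw [pow_eq_pow_mod k hζ, hk, ← pow_eq_pow_mod 1 hζ, pow_one]

theorem conj_pow_eq_pow_pow {P : Type*} [Group P] {g y : P} {k : ℕ}
    (h : y⁻¹ * g * y = g ^ k) (m : ℕ) : (y ^ m)⁻¹ * g * y ^ m = g ^ k ^ m := by
  induction m with
  | zero => simp
  | succ m ih =>
    have h1 : (y ^ (m + 1))⁻¹ * g * y ^ (m + 1) = y⁻¹ * ((y ^ m)⁻¹ * g * y ^ m) * y := by
      rw [pow_succ]
      group
    have h2 := conj_pow (i := k ^ m) (a := y⁻¹) (b := g)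
    rw [inv_inv] at h2
    rw [h1, ih, ← h2, h, ← pow_mul, pow_succ']

theorem modEq_one_of_conj_eq_pow {P : Type*} [Group P] {p c e k : ℕ} (hp : p.Prime)
    {g y : P} (hy : y ^ p ^ e = 1) (hg : orderOf g = p ^ c) (hc : 1 ≤ c)
    (h : y⁻¹ * g * y = g ^ k) : k ≡ 1 [MOD p] := by
  have := Fact.mk hp
  have h1 := conj_pow_eq_pow_pow h (p ^ e)
  rw [hy, inv_one, one_mul, mul_one] at h1
  have h2 : g ^ k ^ p ^ e = g ^ 1 := by rw [← h1, pow_one]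
  rw [pow_eq_pow_iff_modEq, hg] at h2
  have h3 := h2.of_dvd (dvd_pow_self p (Nat.one_le_iff_ne_zero.1 hc))
  rw [← ZMod.natCast_eq_natCast_iff] at h3 ⊢
  rwa [Nat.cast_pow, ZMod.pow_card_pow] at h3

theorem modEq_one_of_conj_eq_pow_of_not_isConj {P : Type*} [Group P] {p b c e k k₀ : ℕ}
    (hp : p.Prime) (hodd : Odd p) {g y : P} (hy : y ^ p ^ e = 1) (hg : orderOf g = p ^ c)
    (hc : 1 ≤ c) (hb : 1 ≤ b) (hk₀ : k₀ ≡ 1 [MOD p ^ b]) (hnot : ¬IsConj (g ^ k₀) g)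
    (h : y⁻¹ * g * y = g ^ k) : k ≡ 1 [MOD p ^ (b + 1)] := by
  by_contra hk
  obtain ⟨m, hm⟩ := exists_pow_modEq hp hodd (c := c) hb
    (modEq_one_of_conj_eq_pow hp hy hg hc h) hk hk₀
  apply hnot
  rw [← hg, ← pow_eq_pow_iff_modEq, ← conj_pow_eq_pow_pow h m] at hm
  rw [← hm, isConj_comm, isConj_iff]
  exact ⟨(y ^ m)⁻¹, by simp⟩

theorem natCard_conj_mem_zpowers {P : Type*} [Group P] [Finite P] (g : P) :
    Nat.card {y : P // y⁻¹ * g * y ∈ Subgroup.zpowers g} =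
      Nat.card (Subgroup.normalizer (Subgroup.zpowers g : Set P)) := by
  refine Nat.card_congr (Equiv.subtypeEquiv (Equiv.inv P) fun y => ?_)
  rw [Equiv.inv_apply]
  constructor
  · intro h
    refine Subgroup.mem_normalizer_fintype fun x hx => ?_
    obtain ⟨k, rfl⟩ := hx
    have := conj_zpow (i := k) (a := y⁻¹) (b := g)
    beta_reduce
    rw [← this, inv_inv]
    exact Subgroup.zpow_mem _ h k
  · intro h
    have := (Subgroup.mem_normalizer_iff.1 h g).1 (Subgroup.mem_zpowers g)
    rwa [inv_inv] at this

theorem mem_charRing_of_commutative {P : Type} [Group P] [Finite P]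
    (hcomm : ∀ a b : P, a * b = b * a) (g : P) {ζ : ℂ} (hζ : ζ ^ orderOf g = 1) :
    ζ ∈ charRing P := by
  have h := mul_mem_charRing_of_conj (⊤ : Subgroup P) (fun a b => Subtype.ext (hcomm a b))
    (Subgroup.mem_top g) hζ dvd_rfl (fun y _ => ⟨1, rfl, by
      rw [hcomm, ← mul_assoc, mul_inv_cancel, one_mul, pow_one]⟩) (r := 1) (by
      rw [one_mul]
      rfl)
  rwa [Nat.cast_one, one_mul] at h

theorem mem_charRing_of_pow_prime_eq_one {P : Type} [Group P] [Finite P] {p e : ℕ}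
    (hp : p.Prime) (he : 1 ≤ e) (hP : Nat.card P = p ^ e) {ζ : ℂ} (hζ : ζ ^ p = 1) :
    ζ ∈ charRing P := by
  have := Fact.mk hp
  obtain ⟨M, hM⟩ := Sylow.exists_subgroup_card_pow_prime (G := P) p (n := e - 1)
    (hP ▸ pow_dvd_pow p (Nat.sub_le e 1))
  have hidx : M.index = p := by
    have h := M.card_mul_index
    rw [hM, hP, ← Nat.sub_add_cancel he, pow_succ, Nat.add_sub_cancel] at h
    exact Nat.eq_of_mul_eq_mul_left (pow_pos hp.pos _) h
  have hnormal : M.Normal := Subgroup.normal_of_index_eq_minFac_card (by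
    rw [hidx, hP, hp.pow_minFac (Nat.one_le_iff_ne_zero.1 he)])
  have hcard : Nat.card (P ⧸ M) = p := hidx
  have hcyc : IsCyclic (P ⧸ M) := isCyclic_of_prime_card hcard
  obtain ⟨x, hx⟩ := isCyclic_iff_exists_orderOf_eq_natCard.1 hcyc
  refine charRing_le_of_surjective (QuotientGroup.mk' M) (QuotientGroup.mk'_surjective M)
    (mem_charRing_of_commutative (fun a b => ?_) x (by rw [hx, hcard, hζ]))
  exact hcyc.commGroup.mul_comm a b

theorem mul_mem_charRing_of_central {P : Type} [Group P] [Finite P] {p e c : ℕ}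
    (hp : p.Prime) (hP : Nat.card P = p ^ e) {g : P} (hg : orderOf g = p ^ c) (hc : c + 1 = 3)
    (hcen : ∀ y : P, y⁻¹ * g * y = g) {ζ : ℂ} (hζ : ζ ^ p ^ c = 1) :
    ((p ^ (e - min 3 e) : ℕ) : ℂ) * ζ ∈ charRing P := by
  have := Fact.mk hp
  have hce : c ≤ e := (Nat.pow_dvd_pow_iff_le_right hp.one_lt).1
    (hg ▸ hP ▸ orderOf_dvd_natCard g)
  obtain ⟨D, hD, hle⟩ := Sylow.exists_subgroup_card_pow_prime_le (G := P) p (n := c)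
    (m := min 3 e) (hP ▸ pow_dvd_pow p (min_le_right 3 e)) (Subgroup.zpowers g)
    (by rw [Nat.card_zpowers, hg]) (by omega)
  have hgD : g ∈ D := hle (Subgroup.mem_zpowers g)
  have hcomm : ∀ a b : D, a * b = b * a := by
    have hcenD : (⟨g, hgD⟩ : D) ∈ Subgroup.center D := by
      rw [Subgroup.mem_center_iff]
      rintro ⟨y, hy⟩
      refine Subtype.ext ?_
      have := hcen y
      rw [mul_assoc, inv_mul_eq_iff_eq_mul] at this
      exact this.symm
    have hZ : Subgroup.zpowers (⟨g, hgD⟩ : D) ≤ Subgroup.center D := by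
      rwa [Subgroup.zpowers_le]
    have hnormal : (Subgroup.zpowers (⟨g, hgD⟩ : D)).Normal :=
      ⟨fun n hn y => by rwa [Subgroup.mem_center_iff.1 (hZ hn) y, mul_inv_cancel_right]⟩
    have hq := (Subgroup.zpowers (⟨g, hgD⟩ : D)).card_mul_index
    rw [Nat.card_zpowers, Subgroup.orderOf_mk, hg, hD] at hq
    have hcyc : IsCyclic (D ⧸ Subgroup.zpowers (⟨g, hgD⟩ : D)) := by
      obtain h | h : min 3 e = c ∨ min 3 e = c + 1 := by omega
      · rw [h] at hq
        have : (Subgroup.zpowers (⟨g, hgD⟩ : D)).index = 1 :=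
          Nat.eq_of_mul_eq_mul_left (pow_pos hp.pos c) (by rw [hq, mul_one])
        have : Subsingleton (D ⧸ Subgroup.zpowers (⟨g, hgD⟩ : D)) :=
          (Nat.card_eq_one_iff_unique.1 this).1
        infer_instance
      · rw [h, pow_succ] at hq
        exact isCyclic_of_prime_card (p := p)
          (Nat.eq_of_mul_eq_mul_left (pow_pos hp.pos c) hq)
    have := MonoidHom.isMulCommutative_of_isCyclic_of_ker_le_center
      (QuotientGroup.mk' (Subgroup.zpowers (⟨g, hgD⟩ : D))) (by rwa [QuotientGroup.ker_mk'])
    exact this.is_comm.comm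
  refine mul_mem_charRing_of_conj D hcomm hgD hζ (dvd_of_eq hg.symm)
    (fun y _ => ⟨1, rfl, by rw [hcen, pow_one]⟩) ?_
  rw [hD, ← pow_add, Nat.sub_add_cancel (min_le_right 3 e), ← hP]
  exact Nat.card_congr (Equiv.subtypeUnivEquiv fun y => by rwa [hcen])

/-- The conjugacy exponent of a `p`-group, and the multiples of roots of unity that it
forces into the character ring. -/
theorem exists_conj_exponent {P : Type} [Group P] [Finite P] {p e : ℕ} (hp : p.Prime)
    (hodd : Odd p) (he : 1 ≤ e) (hP : Nat.card P = p ^ e) :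
    ∃ b, 1 ≤ b ∧ b ≤ e ∧ (∀ (h : P) (k : ℕ), k ≡ 1 [MOD p ^ b] → IsConj (h ^ k) h) ∧
      ∀ ζ : ℂ, ζ ^ p ^ b = 1 → ((p ^ (e - min 3 e) : ℕ) : ℂ) * ζ ∈ charRing P := by
  classical
  have := Fact.mk hp
  have hpe : ∀ y : P, y ^ p ^ e = 1 := fun y => hP ▸ pow_card_eq_one'
  have hex : ∃ b, 1 ≤ b ∧ ∀ (h : P) (k : ℕ), k ≡ 1 [MOD p ^ b] → IsConj (h ^ k) h := by
    refine ⟨e, he, fun h k hk => ?_⟩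
    rw [pow_eq_pow_iff_modEq.2 (hk.of_dvd (orderOf_dvd_of_pow_eq_one (hpe h))), pow_one]
  obtain ⟨hb1, hbconj⟩ := Nat.find_spec hex
  have hmin := fun m => Nat.find_min hex (m := m)
  have hbe : Nat.find hex ≤ e := Nat.find_min' hex ⟨he, fun h k hk => by
    rw [pow_eq_pow_iff_modEq.2 (hk.of_dvd (orderOf_dvd_of_pow_eq_one (hpe h))), pow_one]⟩
  revert hb1 hbconj hmin hbe
  generalize Nat.find hex = b
  intro hb1 hbconj hmin hbe
  refine ⟨b, hb1, hbe, hbconj, fun ζ hζ => ?_⟩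
  obtain rfl | ⟨b, rfl, hb⟩ : b = 1 ∨ ∃ b', b = b' + 1 ∧ 1 ≤ b' := by
    obtain h | h := eq_or_lt_of_le hb1
    · exact .inl h.symm
    · exact .inr ⟨b - 1, by omega, by omega⟩
  · rw [pow_one] at hζ
    exact mul_mem (natCast_mem _ _) (mem_charRing_of_pow_prime_eq_one hp he hP hζ)
  have hnot := hmin b (Nat.lt_succ_self b)
  push Not at hnot
  obtain ⟨g, k₀, hk₀, hg⟩ := hnot hb
  obtain ⟨c, hce, hc⟩ := (Nat.dvd_prime_pow hp).1 (orderOf_dvd_of_pow_eq_one (hpe g))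
  have hbc : b + 1 ≤ c := by
    by_contra hlt
    apply hg
    rw [pow_eq_pow_iff_modEq.2 (hk₀.of_dvd (hc ▸ pow_dvd_pow p (by omega))), pow_one]
  have hkey : ∀ (y : P), y⁻¹ * g * y ∈ Subgroup.zpowers g →
      ∃ k, k ≡ 1 [MOD p ^ (b + 1)] ∧ y⁻¹ * g * y = g ^ k := by
    intro y hy
    obtain ⟨k, hk⟩ := mem_powers_iff_mem_zpowers.2 hy
    exact ⟨k, modEq_one_of_conj_eq_pow_of_not_isConj hp hodd (hpe y) hc (by omega) hb hk₀ hg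
      hk.symm, hk.symm⟩
  have hNcard := natCard_conj_mem_zpowers g
  set N := Subgroup.normalizer (Subgroup.zpowers g : Set P) with hN
  have hzN : Subgroup.zpowers g ≤ N := Subgroup.le_normalizer
  obtain ⟨d, hde, hd⟩ := (Nat.dvd_prime_pow hp).1 (hP ▸ N.card_subgroup_dvd_card)
  have hcd : c ≤ d := by
    have := Subgroup.card_dvd_of_le hzN
    rw [Nat.card_zpowers, hc, hd] at this
    exact (Nat.pow_dvd_pow_iff_le_right hp.one_lt).1 this
  have hmem : ((p ^ (d - c) : ℕ) : ℂ) * ζ ∈ charRing P := by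
    refine mul_mem_charRing_of_conj (Subgroup.zpowers g) ?_ (Subgroup.mem_zpowers g) hζ
      (hc ▸ pow_dvd_pow p hbc) hkey ?_
    · intro a b
      exact (Subgroup.zpowers_isMulCommutative g).is_comm.comm a b
    · rw [hNcard, hd, Nat.card_zpowers, hc, ← pow_add, Nat.sub_add_cancel hcd]
  have hreduce : d - c ≤ e - min 3 e →
      ((p ^ (e - min 3 e) : ℕ) : ℂ) * ζ ∈ charRing P := by
    intro hle
    rw [← Nat.sub_add_cancel hle, pow_add, Nat.cast_mul, mul_assoc]
    exact mul_mem (natCast_mem _ _) hmem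
  by_cases hc3 : 3 ≤ c
  · exact hreduce (by omega)
  by_cases hdlt : d < e
  · exact hreduce (by omega)
  have hb2 : b + 1 = c := by omega
  refine mul_mem_charRing_of_central hp hP hc (by omega) (fun y => ?_) (hb2 ▸ hζ)
  have htop : N = ⊤ := Subgroup.eq_top_of_card_eq N (by rw [hd, hP]; congr 1; omega)
  have hy : y⁻¹ * g * y ∈ Subgroup.zpowers g := by
    have : y⁻¹ ∈ N := htop ▸ Subgroup.mem_top _
    have := (Subgroup.mem_normalizer_iff.1 this g).1 (Subgroup.mem_zpowers g)
    rwa [inv_inv] at this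
  obtain ⟨k, hk, h⟩ := hkey y hy
  rw [h, pow_eq_pow_iff_modEq.2 (by rwa [hc, ← hb2] : k ≡ 1 [MOD orderOf g]), pow_one]

/-- In a finite nilpotent group of odd order, the conjugacy exponents of the Sylow subgroups
combine to a conjugacy exponent of the whole group. -/
theorem exists_conj_exponent_of_isNilpotent {G : Type} [Group G] [Finite G]
    (hnil : Group.IsNilpotent G) (hodd : Odd (Nat.card G)) :
    ∃ b : ℕ → ℕ, (∀ p ∈ (Nat.card G).primeFactors,
        1 ≤ b p ∧ b p ≤ (Nat.card G).factorization p ∧ ∀ ζ : ℂ, ζ ^ p ^ b p = 1 →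
          ((p ^ ((Nat.card G).factorization p - min 3 ((Nat.card G).factorization p)) : ℕ) : ℂ) *
            ζ ∈ charRing G) ∧
      ∀ (h : G) (k : ℕ), k ≡ 1 [MOD ∏ p ∈ (Nat.card G).primeFactors, p ^ b p] →
        IsConj (h ^ k) h := by
  classical
  have hnormal := (Group.isNilpotent_of_finite_tfae (G := G)).out 0 3 |>.1 hnil
  obtain ⟨φ⟩ := (Group.isNilpotent_of_finite_tfae (G := G)).out 0 4 |>.1 hnil
  have hpp : ∀ p : (Nat.card G).primeFactors, (p : ℕ).Prime :=
    fun p => Nat.prime_of_mem_primeFactors p.2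
  have hlocal : ∀ p : (Nat.card G).primeFactors, ∃ b, 1 ≤ b ∧
      b ≤ (Nat.card G).factorization p ∧
      (∀ P : Sylow p G, ∀ (h : P) (k : ℕ), k ≡ 1 [MOD (p : ℕ) ^ b] → IsConj (h ^ k) h) ∧
      ∀ ζ : ℂ, ζ ^ (p : ℕ) ^ b = 1 →
        (((p : ℕ) ^ ((Nat.card G).factorization p -
          min 3 ((Nat.card G).factorization p)) : ℕ) : ℂ) * ζ ∈ charRing G := by
    intro p
    have := Fact.mk (hpp p)
    let P : Sylow p G := default
    obtain ⟨b, h1, h2, h3, h4⟩ := exists_conj_exponent (P := P) (hpp p)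
      (hodd.of_dvd_nat (Nat.dvd_of_mem_primeFactors p.2))
      ((hpp p).factorization_pos_of_dvd Nat.card_pos.ne' (Nat.dvd_of_mem_primeFactors p.2))
      P.card_eq_multiplicity
    let _ := Sylow.unique_of_normal P (hnormal p this P)
    refine ⟨b, h1, h2, fun Q => ?_, fun ζ hζ => ?_⟩
    · obtain rfl := Subsingleton.elim P Q
      exact h3
    · let f : G →* P := ((Pi.evalMonoidHom (fun P : Sylow p G => (P : Subgroup G)) P).comp
        (Pi.evalMonoidHom (fun p : (Nat.card G).primeFactors =>
          ∀ P : Sylow p G, (P : Subgroup G)) p)).comp φ.symm.toMonoidHom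
      have hf : Function.Surjective f :=
        (Function.surjective_eval (β := fun P : Sylow p G => (P : Subgroup G)) P).comp
          ((Function.surjective_eval (β := fun p : (Nat.card G).primeFactors =>
            ∀ P : Sylow p G, (P : Subgroup G)) p).comp φ.symm.surjective)
      exact charRing_le_of_surjective f hf (h4 ζ hζ)
  choose b hb1 hb2 hb3 hb4 using hlocal
  refine ⟨fun p => if hp : p ∈ (Nat.card G).primeFactors then b ⟨p, hp⟩ else 0,
    fun p hp => ?_, fun h k hk => ?_⟩
  · simp only [dif_pos hp]
    exact ⟨hb1 ⟨p, hp⟩, hb2 ⟨p, hp⟩, hb4 ⟨p, hp⟩⟩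
  · have hconj : ∀ (p : (Nat.card G).primeFactors) (P : Sylow p G),
        IsConj (φ.symm h p P ^ k) (φ.symm h p P) := by
      intro p P
      refine hb3 p P _ k (hk.of_dvd ?_)
      refine dvd_trans ?_ (Finset.dvd_prod_of_mem _ p.2)
      simp only [dif_pos p.2, Subtype.coe_eta, dvd_refl]
    simp only [isConj_iff] at hconj ⊢
    choose c hc using hconj
    refine ⟨φ c, φ.symm.injective ?_⟩
    ext p P
    simp only [map_mul, map_inv, map_pow, MulEquiv.symm_apply_apply]
    exact congrArg Subtype.val (hc p P)

/-- A linear map `f` with `f ^ (m * N) = 1` whose powers `f ^ (1 + m * t)` all have the same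
trace has its trace in the `m`-th cyclotomic field. -/
theorem trace_mem_cycField {V : Type*} [AddCommGroup V] [Module ℂ V] [Module.Finite ℂ V]
    {f : Module.End ℂ V} {m N : ℕ} (hN : N ≠ 0) (hf : f ^ (m * N) = 1)
    (htr : ∀ t, LinearMap.trace ℂ V (f ^ (1 + m * t)) = LinearMap.trace ℂ V f) :
    LinearMap.trace ℂ V f ∈ cycField m := by
  set S : Module.End ℂ V := ∑ t ∈ Finset.range N, (f ^ m) ^ t with hS
  have hNC : (N : ℂ) ≠ 0 := Nat.cast_ne_zero.2 hN
  have hfS : f ^ m * S = S := by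
    have := mul_geom_sum (f ^ m) N
    rw [← pow_mul, hf, sub_self, sub_mul, one_mul, sub_eq_zero] at this
    exact this
  have hcomm : Commute (f ^ m) f := (Commute.refl f).pow_left m
  have htrace : LinearMap.trace ℂ V (f * S) = N * LinearMap.trace ℂ V f := by
    rw [hS, Finset.mul_sum, map_sum, Finset.sum_congr rfl fun t _ => by
      rw [← pow_mul, ← pow_succ', Nat.add_comm, htr t]]
    simp
  have hroots : ∀ μ ∈ (LinearMap.charpoly (f * S)).roots, μ ∈ cycField m := by
    intro μ hμ
    have hμ' := (Module.End.hasEigenvalue_iff_isRoot_charpoly (f * S) μ).2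
      (Polynomial.isRoot_of_mem_roots hμ)
    obtain ⟨v, hv⟩ := hμ'.exists_hasEigenvector
    obtain rfl | hμ0 := eq_or_ne μ 0
    · exact zero_mem _
    have hAv : (f * S) v = μ • v := hv.apply_eq_smul
    have hmv : (f ^ m) v = v := by
      have h : (f ^ m * (f * S)) v = (f * S) v := by
        rw [← mul_assoc, hcomm.eq, mul_assoc, hfS]
      rw [Module.End.mul_apply, hAv, map_smul] at h
      exact smul_right_injective V hμ0 h
    have hSv : S v = (N : ℂ) • v := by
      have : ∀ t : ℕ, ((f ^ m) ^ t) v = v := by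
        intro t
        induction t with
        | zero => rfl
        | succ t ih => rw [pow_succ, Module.End.mul_apply, hmv, ih]
      simp [hS, LinearMap.sum_apply, this, Nat.cast_smul_eq_nsmul]
    have hfv : f v = (μ / N) • v := by
      rw [Module.End.mul_apply, hSv, map_smul] at hAv
      rw [div_eq_inv_mul, mul_smul, ← hAv, smul_smul, inv_mul_cancel₀ hNC, one_smul]
    have hpow : ∀ t : ℕ, (f ^ t) v = (μ / N) ^ t • v := by
      intro t
      induction t with
      | zero => simp
      | succ t ih => rw [pow_succ, Module.End.mul_apply, hfv, map_smul, ih, smul_smul, pow_succ']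
    have hroot : (μ / N) ^ m = 1 := by
      have h := hpow m
      rw [hmv] at h
      exact smul_left_injective ℂ hv.2 (by simpa using h.symm)
    have : μ = (μ / N) * N := by field_simp
    rw [this]
    exact mul_mem (Subfield.subset_closure hroot) (natCast_mem _ N)
  have hsum : LinearMap.trace ℂ V (f * S) ∈ cycField m := by
    rw [Module.End.trace_eq_sum_roots_charpoly_of_splits (IsAlgClosed.splits _)]
    exact multiset_sum_mem _ hroots
  have : LinearMap.trace ℂ V f = LinearMap.trace ℂ V (f * S) / N := by
    rw [htrace]
    field_simp
  rw [this]
  exact div_mem hsum (natCast_mem _ N)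

theorem charField_le_cycField {G : Type} [Group G] [Finite G] {m : ℕ} (hm : m ∣ Nat.card G)
    (hconj : ∀ (h : G) (k : ℕ), k ≡ 1 [MOD m] → IsConj (h ^ k) h) :
    charField G ≤ cycField m := by
  refine Subfield.closure_le.2 ?_
  rintro z ⟨V, -, g, rfl⟩
  obtain ⟨N, hN⟩ := hm
  refine trace_mem_cycField (f := V.ρ g) (N := N) ?_ ?_ fun t => ?_
  · rintro rfl
    exact Nat.card_pos.ne' hN
  · rw [← map_pow, ← hN, pow_card_eq_one', map_one]
  · rw [← map_pow]
    obtain ⟨c, hc⟩ := isConj_iff.1 (hconj g (1 + m * t) (by simp [Nat.ModEq])).symm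
    rw [← hc]
    exact V.char_conj g c

theorem mem_adjoin_of_mem_cycField {m : ℕ} (hm : m ≠ 0) {x : ℂ} (hx : x ∈ cycField m)
    (hint : IsIntegral ℤ x) :
    ∃ ζ : ℂ, ζ ^ m = 1 ∧ x ∈ Algebra.adjoin ℤ {ζ} := by
  have := NeZero.mk hm
  have : IsCyclotomicExtension {m} ℚ (CyclotomicField m ℚ) :=
    CyclotomicField.isCyclotomicExtension m ℚ
  let φ : CyclotomicField m ℚ →ₐ[ℚ] ℂ := IsAlgClosed.lift
  obtain ⟨ζ, hζ⟩ : ∃ ζ : CyclotomicField m ℚ, IsPrimitiveRoot ζ m :=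
    ⟨_, IsCyclotomicExtension.zeta_spec m ℚ (CyclotomicField m ℚ)⟩
  have hφζ : IsPrimitiveRoot (φ ζ) m := hζ.map_of_injective φ.injective
  have hle : cycField m ≤ φ.toRingHom.fieldRange := by
    refine Subfield.closure_le.2 fun z hz => ?_
    obtain ⟨i, -, rfl⟩ := hφζ.eq_pow_of_pow_eq_one hz
    exact ⟨ζ ^ i, map_pow _ _ _⟩
  obtain ⟨y, rfl⟩ := hle hx
  have hy : IsIntegral ℤ y :=
    (isIntegral_algHom_iff (φ.restrictScalars ℤ) φ.injective).1 hint
  have hcl := IsCyclotomicExtension.Rat.isIntegralClosure_adjoin_singleton hζ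
  obtain ⟨w, rfl⟩ := hcl.isIntegral_iff.1 hy
  refine ⟨φ ζ, hφζ.pow_eq_one, ?_⟩
  have h : φ.restrictScalars ℤ w ∈
      (Algebra.adjoin ℤ {ζ}).map (φ.restrictScalars ℤ) := ⟨w, w.2, rfl⟩
  rw [AlgHom.map_adjoin, Set.image_singleton] at h
  exact h

theorem exists_mul_eq_of_pow_mul_eq_one {a b : ℕ} (hab : a.Coprime b) {ζ : ℂ}
    (hζ : ζ ^ (a * b) = 1) (h0 : a * b ≠ 0) :
    ∃ ξ η : ℂ, ξ ^ a = 1 ∧ η ^ b = 1 ∧ ζ = ξ * η := by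
  have hz : ζ ≠ 0 := by
    rintro rfl
    rw [zero_pow h0] at hζ
    exact zero_ne_one hζ
  have hζ' : ζ ^ ((a : ℤ) * b) = 1 := by exact_mod_cast hζ
  refine ⟨ζ ^ ((b : ℤ) * a.gcdB b), ζ ^ ((a : ℤ) * a.gcdA b), ?_, ?_, ?_⟩
  · rw [← zpow_natCast, ← zpow_mul, mul_right_comm, mul_comm (b : ℤ), zpow_mul, hζ', one_zpow]
  · rw [← zpow_natCast, ← zpow_mul, mul_right_comm, zpow_mul, hζ', one_zpow]
  · have h := Nat.gcd_eq_gcd_ab a b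
    rw [hab.gcd_eq_one] at h
    rw [← zpow_add₀ hz, add_comm, ← h, Nat.cast_one, zpow_one]

theorem prod_mul_mem_of_pow_prod_eq_one (R : Subring ℂ) (s : Finset ℕ) (hs : ∀ p ∈ s, p.Prime)
    (b c : ℕ → ℕ)
    (h : ∀ p ∈ s, ∀ ζ : ℂ, ζ ^ p ^ b p = 1 → (c p : ℂ) * ζ ∈ R) {ζ : ℂ}
    (hζ : ζ ^ ∏ p ∈ s, p ^ b p = 1) : ((∏ p ∈ s, c p : ℕ) : ℂ) * ζ ∈ R := by
  induction s using Finset.induction_on generalizing ζ with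
  | empty =>
    rw [Finset.prod_empty, pow_one] at hζ
    simp [hζ]
  | insert p s hp ih =>
    rw [Finset.prod_insert hp] at hζ ⊢
    have hcop : (p ^ b p).Coprime (∏ q ∈ s, q ^ b q) := by
      refine Nat.Coprime.prod_right fun q hq => Nat.Coprime.pow _ _ ?_
      rw [Nat.coprime_primes (hs p (Finset.mem_insert_self p s))
        (hs q (Finset.mem_insert_of_mem hq))]
      rintro rfl
      exact hp hq
    obtain ⟨ξ, η, hξ, hη, rfl⟩ := exists_mul_eq_of_pow_mul_eq_one hcop hζ (by
      rw [← Finset.prod_insert (f := fun q => q ^ b q) hp]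
      exact Finset.prod_ne_zero_iff.2 fun q hq => pow_ne_zero _ (hs q hq).ne_zero)
    have h1 := h p (Finset.mem_insert_self p s) ξ hξ
    have h2 := ih (fun q hq => hs q (Finset.mem_insert_of_mem hq))
      (fun q hq => h q (Finset.mem_insert_of_mem hq)) hη
    convert mul_mem h1 h2 using 1
    push_cast
    ring

theorem mul_mem_of_mem_adjoin (R : Subring ℂ) {c ζ x : ℂ} (h : ∀ i : ℕ, c * ζ ^ i ∈ R)
    (hx : x ∈ Algebra.adjoin ℤ {ζ}) : c * x ∈ R := by
  rw [Algebra.adjoin_singleton_eq_range_aeval] at hx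
  obtain ⟨f, rfl⟩ := hx
  change c * Polynomial.aeval ζ f ∈ R
  rw [Polynomial.aeval_eq_sum_range, Finset.mul_sum]
  refine sum_mem fun i _ => ?_
  rw [mul_smul_comm]
  exact zsmul_mem (h i) _

/-- For a nilpotent group `G` of odd order,
`|G| · ℤ_{ℚ(G)} ⊆ q · ℤ[G]` where `q = ∏_p min(p^3, |G|_p)` over the primes `p ∣ |G|`. -/
theorem card_mul_ringOfIntIn_subset_of_nilpotent_odd (G : Type) [Group G] [Finite G]
    (hnil : Group.IsNilpotent G) (hodd : Odd (Nat.card G)) :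
    ∀ x ∈ ringOfIntIn (charField G), ∃ y ∈ charRing G,
      (Nat.card G : ℂ) * x =
        ((∏ p ∈ (Nat.card G).primeFactors,
            min (p ^ 3) (p ^ (Nat.card G).factorization p) : ℕ) : ℂ) * y := by
  intro x hx
  obtain ⟨b, hb, hconj⟩ := exists_conj_exponent_of_isNilpotent hnil hodd
  have hn : Nat.card G ≠ 0 := Nat.card_pos.ne'
  have hcard : ∏ p ∈ (Nat.card G).primeFactors, p ^ (Nat.card G).factorization p = Nat.card G :=
    Nat.prod_factorization_pow_eq_self hn
  have hm : ∏ p ∈ (Nat.card G).primeFactors, p ^ b p ∣ Nat.card G := by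
    conv_rhs => rw [← hcard]
    exact Finset.prod_dvd_prod_of_dvd _ _ fun p hp => pow_dvd_pow p (hb p hp).2.1
  obtain ⟨ζ, hζ, hxζ⟩ := mem_adjoin_of_mem_cycField (ne_zero_of_dvd_ne_zero hn hm)
    (charField_le_cycField hm hconj hx.2) hx.1
  refine ⟨_, mul_mem_of_mem_adjoin (charRing G) (fun i => prod_mul_mem_of_pow_prod_eq_one
    (charRing G) (Nat.card G).primeFactors (fun p => Nat.prime_of_mem_primeFactors) b
    (fun p => p ^ ((Nat.card G).factorization p - min 3 ((Nat.card G).factorization p)))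
    (fun p hp => (hb p hp).2.2) (ζ := ζ ^ i) ?_) hxζ, ?_⟩
  · rw [← pow_mul, mul_comm, pow_mul, hζ, one_pow]
  · rw [← mul_assoc, ← Nat.cast_mul, ← Finset.prod_mul_distrib]
    congr 2
    refine hcard.symm.trans (Finset.prod_congr rfl fun p hp => ?_)
    have hmono := pow_right_mono₀ (Nat.prime_of_mem_primeFactors hp).one_le
    rw [← hmono.map_min, ← pow_add, Nat.add_sub_cancel' (min_le_right _ _)]
end
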